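/- arXiv:2011.12779 — 2 statements merged into one kernel-verified Lean document; each statement's English description precedes it below -/
import Mathlib

section
/- Let n ≥ 2, let p, q ∈ [2,∞) and s, t ∈ (0,1) satisfy p ≤ q, t ≤ s, 1/p' ≤ tq/(sp) ≤ 1 (where p' = p/(p−1)) and sp < n, and let a : ℝⁿ×ℝⁿ → ℝ be measurable with 0 ≤ a(x,y) ≤ M and a(x,y) = a(y,x). Fix δ₀ > 0 and let f ∈ L^{p_* + δ₀}_loc(ℝⁿ) with p_* = np'/(n+sp'). Let u ∈ W^{s,p}(ℝⁿ) ∩ L^∞(ℝⁿ) be a bounded weak solution of the nonlocal double phase equation with data f whose energy ℰ(u,u) is finite. Then there exist positive constants ε₁ and ε₂ such that u ∈ W^{s+ε₁, p+ε₂}_loc(ℝⁿ); moreover, if (s+ε₁)(p+ε₂) > n, then u is locally Hölder continuous. -/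
open MeasureTheory Metric Set
open scoped ENNReal

noncomputable section

/-- `ℝⁿ` as a Euclidean space. -/
abbrev En (n : ℕ) := EuclideanSpace ℝ (Fin n)

/-- The Hölder conjugate `p' = p/(p−1)`. -/
def pC (p : ℝ) : ℝ := p / (p - 1)

/-- The lower Sobolev exponent `p_* = np'/(n+sp')`. -/
def pStar (n : ℕ) (p s : ℝ) : ℝ := (n : ℝ) * pC p / ((n : ℝ) + s * pC p)

/-- The integrand `P(x,y,u)` of the double phase energy `ℰ(u,u)`:
`|u(x)−u(y)|^p/|x−y|^{n+sp} + a(x,y)|u(x)−u(y)|^q/|x−y|^{n+tq}`. -/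
def energyIntegrand (n : ℕ) (p q s t : ℝ) (a : En n × En n → ℝ) (u : En n → ℝ)
    (z : En n × En n) : ℝ :=
  |u z.1 - u z.2| ^ p / ‖z.1 - z.2‖ ^ ((n : ℝ) + s * p)
    + a z * |u z.1 - u z.2| ^ q / ‖z.1 - z.2‖ ^ ((n : ℝ) + t * q)

/-- The integrand of the double phase form `ℰ(u,φ)`. -/
def formIntegrand (n : ℕ) (p q s t : ℝ) (a : En n × En n → ℝ) (u φ : En n → ℝ)
    (z : En n × En n) : ℝ :=
  |u z.1 - u z.2| ^ (p - 2) * (u z.1 - u z.2) * (φ z.1 - φ z.2)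
      / ‖z.1 - z.2‖ ^ ((n : ℝ) + s * p)
    + a z * (|u z.1 - u z.2| ^ (q - 2) * (u z.1 - u z.2) * (φ z.1 - φ z.2))
        / ‖z.1 - z.2‖ ^ ((n : ℝ) + t * q)

/-- `u ∈ W^{s,p}(ℝⁿ)`: `u` is measurable, `u ∈ L^p(ℝⁿ)`, and the Gagliardo seminorm
`∬ |u(x)−u(y)|^p/|x−y|^{n+sp} dy dx` is finite. -/
def MemWsp (n : ℕ) (s p : ℝ) (u : En n → ℝ) : Prop :=
  Measurable u ∧ (∫⁻ x, ENNReal.ofReal (|u x| ^ p)) < ⊤ ∧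
    (∫⁻ z : En n × En n,
      ENNReal.ofReal (|u z.1 - u z.2| ^ p / ‖z.1 - z.2‖ ^ ((n : ℝ) + s * p))) < ⊤

/-- `u` is a bounded weak solution of `ℒu = f`: the double phase energy `ℰ(u,u)` is finite
and `ℰ(u,φ) = ∫ fφ` for every test function `φ ∈ C_c^∞(ℝⁿ)`. -/
def IsBoundedWeakSolution (n : ℕ) (p q s t : ℝ) (a : En n × En n → ℝ)
    (u f : En n → ℝ) : Prop :=
  (∫⁻ z : En n × En n, ENNReal.ofReal (energyIntegrand n p q s t a u z)) < ⊤ ∧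
  ∀ φ : En n → ℝ, ContDiff ℝ (⊤ : ℕ∞) φ → HasCompactSupport φ →
    (∫ z : En n × En n, formIntegrand n p q s t a u φ z) = ∫ x, f x * φ x


section


lemma aux_young (p δ U w : ℝ) (hp : 1 ≤ p) (hδ : 0 < δ) (hU : 0 ≤ U) (hw : 0 ≤ w) :
    U ^ (p - 1) * w ≤ δ * U ^ p + δ ^ (1 - p) * w ^ p := by
  have h1 : 0 ≤ δ * U ^ p := by positivity
  have h2 : 0 ≤ δ ^ (1 - p) * w ^ p := by positivity
  rcases hU.eq_or_lt with h0 | h0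
  · subst h0
    rcases hp.eq_or_lt with h3 | h3
    · subst h3; simp
    · rw [Real.zero_rpow (by linarith)]; nlinarith
  by_cases h : w ≤ δ * U
  · have : U ^ p = U ^ (p - 1) * U := by
      rw [← Real.rpow_add_one h0.ne']; congr 1; ring
    have h3 : U ^ (p - 1) * w ≤ U ^ (p - 1) * (δ * U) := by gcongr
    nlinarith
  · push Not at h
    have hw0 : 0 < w := lt_of_le_of_lt (by positivity) h
    have h3 : U ≤ w / δ := by rw [le_div_iff₀ hδ]; linarith
    have h4 : U ^ (p - 1) ≤ (w / δ) ^ (p - 1) := Real.rpow_le_rpow hU h3 (by linarith)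
    have h5 : (w / δ) ^ (p - 1) * w = δ ^ (1 - p) * w ^ p := by
      rw [Real.div_rpow hw hδ.le, show (1 - p) = -(p - 1) by ring, Real.rpow_neg hδ.le]
      have : w ^ p = w ^ (p - 1) * w := by
        rw [← Real.rpow_add_one hw0.ne']; congr 1; ring
      rw [this]; field_simp
    have h6 : U ^ (p - 1) * w ≤ (w / δ) ^ (p - 1) * w := by gcongr
    linarith

lemma aux_split (r N b : ℝ) (hr : 1 ≤ r) (hN : 0 < N) (hb : 0 ≤ b) :
    b ≤ N + N ^ (1 - r) * b ^ r := by
  have h2 : 0 ≤ N ^ (1 - r) * b ^ r := by positivity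
  by_cases h : b ≤ N
  · linarith
  · push Not at h
    have hb0 : 0 < b := hN.trans h
    have h1 : b ^ r * N ^ (1 - r) ≥ b ^ r * b ^ (1 - r) := 
      mul_le_mul_of_nonneg_left (Real.rpow_le_rpow_of_nonpos hN h.le (by linarith)) (by positivity)
    rw [← Real.rpow_add hb0] at h1
    simp at h1
    nlinarith

lemma rad_out (n : ℕ) (hn : 2 ≤ n) (β : ℝ) (hβ : 0 < β) :
    ∃ C : ℝ, 0 ≤ C ∧ ∀ h : ℝ, 0 < h → ∀ x : En n,
      ∫⁻ y : En n, ENNReal.ofReal (if h ≤ ‖x - y‖ then ‖x - y‖ ^ (-((n : ℝ) + β)) else 0)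
        ≤ ENNReal.ofReal (C * h ^ (-β)) := by
  have : Nontrivial (Fin n) := Fin.nontrivial_iff_two_le.2 hn
  have : Nontrivial (En n) := inferInstance
  refine ⟨n * (volume.real (ball (0 : En n) 1) * (1 / β)), by positivity, fun h hh x => ?_⟩
  rw [lintegral_sub_left_eq_self (fun y : En n =>
    ENNReal.ofReal (if h ≤ ‖y‖ then ‖y‖ ^ (-((n : ℝ) + β)) else 0)) x]
  set F : ℝ → ℝ := fun r => if h ≤ r then r ^ (-((n : ℝ) + β)) else 0 with hF
  have key : EqOn (fun y : ℝ ↦ y ^ (Module.finrank ℝ (En n) - 1) • F y)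
      ((Ici h).indicator (fun y => y ^ (-β - 1))) (Ioi 0) := by
    intro y hy
    have hy0 : (0 : ℝ) < y := hy
    by_cases hc : h ≤ y
    · simp only [hF, finrank_euclideanSpace, Fintype.card_fin, hc, if_true, smul_eq_mul, mem_Ici, indicator_of_mem]
      rw [← Real.rpow_natCast, ← Real.rpow_add hy0]
      congr 1
      rw [Nat.cast_sub (by omega)]; push_cast; ring
    · simp [hF, hc]
  have hint0 : IntegrableOn (fun y : ℝ => y ^ (-β - 1)) (Ioi h) :=
    integrableOn_Ioi_rpow_of_lt (by linarith) hh
  have hsub : Ici h ∩ Ioi 0 = Ici h := by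
    ext y; simp; intro hy; linarith
  have hintegr : Integrable (fun x : En n => F ‖x‖) := by
    rw [integrable_fun_norm_addHaar volume (f := F), integrableOn_congr_fun key measurableSet_Ioi,
      integrableOn_indicator_iff measurableSet_Ici, hsub]
    exact (integrableOn_Ici_iff_integrableOn_Ioi (by simp)).2 hint0
  have hnn : ∀ x : En n, 0 ≤ F ‖x‖ := by
    intro x; simp only [hF]; split_ifs <;> positivity
  change ∫⁻ y : En n, ENNReal.ofReal (F ‖y‖) ≤ _
  rw [← ofReal_integral_eq_lintegral_ofReal hintegr (Filter.Eventually.of_forall hnn)]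
  apply ENNReal.ofReal_le_ofReal
  rw [integral_fun_norm_addHaar volume F, setIntegral_congr_fun measurableSet_Ioi key,
    setIntegral_indicator measurableSet_Ici, inter_comm, hsub, integral_Ici_eq_integral_Ioi,
    integral_Ioi_rpow_of_lt (by linarith) hh]
  simp only [finrank_euclideanSpace, Fintype.card_fin, smul_eq_mul, nsmul_eq_mul]
  apply le_of_eq
  rw [show -β - 1 + 1 = -β by ring]
  field_simp

lemma rad_in (n : ℕ) (hn : 2 ≤ n) (β : ℝ) (hβ : 0 < β) :
    ∃ C : ℝ, 0 ≤ C ∧ ∀ h : ℝ, 0 < h → ∀ x : En n,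
      ∫⁻ y : En n, ENNReal.ofReal (if ‖x - y‖ < h then ‖x - y‖ ^ (β - (n : ℝ)) else 0)
        ≤ ENNReal.ofReal (C * h ^ β) := by
  have : Nontrivial (Fin n) := Fin.nontrivial_iff_two_le.2 hn
  have : Nontrivial (En n) := inferInstance
  refine ⟨n * (volume.real (ball (0 : En n) 1) * (1 / β)), by positivity, fun h hh x => ?_⟩
  rw [lintegral_sub_left_eq_self (fun y : En n =>
    ENNReal.ofReal (if ‖y‖ < h then ‖y‖ ^ (β - (n : ℝ)) else 0)) x]
  set F : ℝ → ℝ := fun r => if r < h then r ^ (β - (n : ℝ)) else 0 with hF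
  have key : EqOn (fun y : ℝ ↦ y ^ (Module.finrank ℝ (En n) - 1) • F y)
      ((Iio h).indicator (fun y => y ^ (β - 1))) (Ioi 0) := by
    intro y hy
    have hy0 : (0 : ℝ) < y := hy
    by_cases hc : y < h
    · simp only [hF, finrank_euclideanSpace, Fintype.card_fin, hc, if_true, smul_eq_mul, mem_Iio, indicator_of_mem]
      rw [← Real.rpow_natCast, ← Real.rpow_add hy0]
      congr 1
      rw [Nat.cast_sub (by omega)]; push_cast; ring
    · simp [hF, hc]
  have hint0 : IntegrableOn (fun y : ℝ => y ^ (β - 1)) (Ioo 0 h) := by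
    have := intervalIntegral.intervalIntegrable_rpow' (a := 0) (b := h) (r := β - 1) (by linarith)
    rw [intervalIntegrable_iff_integrableOn_Ioo_of_le hh.le] at this
    exact this
  have hsub : Iio h ∩ Ioi 0 = Ioo 0 h := by
    ext y; simp [and_comm]
  have hintegr : Integrable (fun x : En n => F ‖x‖) := by
    rw [integrable_fun_norm_addHaar volume (f := F), integrableOn_congr_fun key measurableSet_Ioi,
      integrableOn_indicator_iff measurableSet_Iio, hsub]
    exact hint0
  have hnn : ∀ x : En n, 0 ≤ F ‖x‖ := by
    intro x; simp only [hF]; split_ifs <;> positivity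
  change ∫⁻ y : En n, ENNReal.ofReal (F ‖y‖) ≤ _
  rw [← ofReal_integral_eq_lintegral_ofReal hintegr (Filter.Eventually.of_forall hnn)]
  apply ENNReal.ofReal_le_ofReal
  rw [integral_fun_norm_addHaar volume F, setIntegral_congr_fun measurableSet_Ioi key,
    setIntegral_indicator measurableSet_Iio, inter_comm, hsub, ← integral_Ioc_eq_integral_Ioo,
    ← intervalIntegral.integral_of_le hh.le, integral_rpow (Or.inl (by linarith))]
  simp only [finrank_euclideanSpace, Fintype.card_fin, smul_eq_mul, nsmul_eq_mul]
  apply le_of_eq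
  rw [show β - 1 + 1 = β by ring, Real.zero_rpow hβ.ne']
  field_simp
  ring

/-- Jensen for finite measures. -/
lemma aux_jensen {α : Type*} [MeasurableSpace α] (μ : Measure α) (p : ℝ) (hp : 1 < p)
    (g : α → ℝ≥0∞) (hg : AEMeasurable g μ) :
    (∫⁻ x, g x ∂μ) ^ p ≤ (μ univ) ^ (p - 1) * ∫⁻ x, g x ^ p ∂μ := by
  have hpq := Real.HolderConjugate.conjExponent hp
  have h := ENNReal.lintegral_mul_le_Lp_mul_Lq μ hpq hg (aemeasurable_const (b := (1 : ℝ≥0∞)))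
  simp only [Pi.mul_apply, mul_one] at h
  calc (∫⁻ x, g x ∂μ) ^ p ≤ _ := ENNReal.rpow_le_rpow h (by linarith)
    _ = (μ univ) ^ (p - 1) * ∫⁻ x, g x ^ p ∂μ := by
      rw [ENNReal.mul_rpow_of_nonneg _ _ (by linarith), ← ENNReal.rpow_mul, ← ENNReal.rpow_mul]
      simp only [ENNReal.one_rpow, lintegral_one]
      have e1 : 1 / p * p = 1 := by field_simp
      have e2 : 1 / p.conjExponent * p = p - 1 := by
        rw [Real.conjExponent]; field_simp
      rw [e1, e2, ENNReal.rpow_one, mul_comm]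

end

section


lemma moll (n : ℕ) (hn : 2 ≤ n) : ∃ C : ℝ, 0 ≤ C ∧ ∀ h : ℝ, 0 < h → ∃ η : En n → ℝ,
    Continuous η ∧ (∀ w, 0 ≤ η w) ∧ Integrable η ∧ ∫ w, η w = 1 ∧
    (∀ w, η w ≠ 0 → 2 * h ≤ ‖w‖ ∧ ‖w‖ ≤ 3 * h) ∧
    (∀ w, η w ≤ C * h ^ (-(n : ℝ))) ∧
    (∀ w w', |η w - η w'| ≤ C * h ^ (-(n : ℝ)) * (‖w - w'‖ / h)) := by
  let c : En n := EuclideanSpace.single ⟨0, by omega⟩ (5 / 2 : ℝ)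
  have hc : ‖c‖ = 5 / 2 := by simp [c]
  let b : ContDiffBump c := ⟨1 / 4, 1 / 2, by norm_num, by norm_num⟩
  let g : En n → ℝ := b.normed volume
  have hcont : Continuous g := b.continuous_normed
  have hcs : HasCompactSupport g := b.hasCompactSupport_normed
  have hsm : ContDiff ℝ 1 g := by exact_mod_cast (b.contDiff_normed (n := 1) (μ := volume))
  obtain ⟨L, hL⟩ := ContDiff.lipschitzWith_of_hasCompactSupport hcs hsm one_ne_zero
  obtain ⟨B, hB⟩ := hcs.exists_bound_of_continuous hcont
  have hB0 : 0 ≤ B := (norm_nonneg _).trans (hB 0)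
  refine ⟨B + L, by positivity, fun h hh => ⟨fun w => h ^ (-(n : ℝ)) * g (h⁻¹ • w), ?_, ?_, ?_, ?_, ?_, ?_, ?_⟩⟩
  · fun_prop
  · intro w; exact mul_nonneg (by positivity) (b.nonneg_normed _)
  · exact ((integrable_comp_smul_iff volume g (inv_ne_zero hh.ne')).2 b.integrable_normed).const_mul _
  · rw [integral_const_mul, Measure.integral_comp_smul volume g h⁻¹, b.integral_normed]
    simp only [finrank_euclideanSpace, Fintype.card_fin, smul_eq_mul, mul_one, inv_pow, inv_inv]
    rw [abs_of_pos (by positivity), Real.rpow_neg hh.le, Real.rpow_natCast]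
    field_simp
  · intro w hw
    have h1 : g (h⁻¹ • w) ≠ 0 := fun h0 => hw (by simp [h0])
    have h2 : h⁻¹ • w ∈ Function.support g := h1
    rw [b.support_normed_eq, mem_ball, dist_eq_norm] at h2
    have h3 : b.rOut = 1 / 2 := rfl
    rw [h3] at h2
    have h4 : ‖h⁻¹ • w‖ = ‖w‖ / h := by
      rw [norm_smul, norm_inv, Real.norm_of_nonneg hh.le]; field_simp
    have h5 := norm_sub_norm_le (h⁻¹ • w) c
    have h6 := norm_sub_norm_le c (h⁻¹ • w)
    rw [norm_sub_rev] at h6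
    rw [h4, hc] at h5 h6
    constructor
    · have : 2 ≤ ‖w‖ / h := by linarith
      rwa [le_div_iff₀ hh] at this
    · have : ‖w‖ / h ≤ 3 := by linarith
      rwa [div_le_iff₀ hh] at this
  · intro w
    have := hB (h⁻¹ • w)
    rw [Real.norm_eq_abs] at this
    have h7 : g (h⁻¹ • w) ≤ B + L := by
      have := le_abs_self (g (h⁻¹ • w)); have := L.coe_nonneg; linarith
    have : 0 ≤ h ^ (-(n : ℝ)) := by positivity
    show h ^ (-(n : ℝ)) * g (h⁻¹ • w) ≤ _
    nlinarith
  · intro w w'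
    have h1 := hL.dist_le_mul (h⁻¹ • w) (h⁻¹ • w')
    rw [Real.dist_eq, dist_eq_norm, ← smul_sub, norm_smul, norm_inv, Real.norm_of_nonneg hh.le] at h1
    rw [← mul_sub, abs_mul, abs_of_nonneg (by positivity : 0 ≤ h ^ (-(n : ℝ)))]
    have h2 : 0 ≤ h ^ (-(n : ℝ)) := by positivity
    have h3 : (0 : ℝ) ≤ h⁻¹ * ‖w - w'‖ := by positivity
    calc h ^ (-(n : ℝ)) * |g (h⁻¹ • w) - g (h⁻¹ • w')| ≤ h ^ (-(n : ℝ)) * ((B + L) * (h⁻¹ * ‖w - w'‖)) := by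
          gcongr; nlinarith
      _ = _ := by field_simp

/-- Gagliardo density. -/
def gP (n : ℕ) (s p : ℝ) (u : En n → ℝ) (z : En n × En n) : ℝ :=
  |u z.1 - u z.2| ^ p / ‖z.1 - z.2‖ ^ ((n : ℝ) + s * p)

lemma gP_nonneg (n : ℕ) (s p : ℝ) (u : En n → ℝ) (z : En n × En n) : 0 ≤ gP n s p u z := by
  unfold gP; positivity

lemma gP_meas (n : ℕ) (s p : ℝ) (u : En n → ℝ) (hu : Measurable u) : Measurable (gP n s p u) := by
  unfold gP; fun_prop

/-- Partial integral over the region away from the diagonal. -/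
def Sx (n : ℕ) (s p : ℝ) (u : En n → ℝ) (h : ℝ) (x : En n) : ℝ≥0∞ :=
  ∫⁻ y, ENNReal.ofReal (if h ≤ ‖x - y‖ then (h / ‖x - y‖) ^ s * gP n s p u (x, y) else 0)

lemma ker_bound (n : ℕ) (hn : 2 ≤ n) (s p : ℝ) (hs : 0 < s) (hp : 1 < p) :
    ∃ C : ℝ, 0 ≤ C ∧ ∀ h : ℝ, 0 < h → ∀ u : En n → ℝ, Measurable u → ∀ x : En n,
      ∀ κ : En n → ℝ, ∀ A : ℝ, 0 ≤ A →
      (∀ y, |κ y| ≤ A * h ^ (-(n : ℝ))) → (∀ y, κ y ≠ 0 → h ≤ ‖x - y‖ ∧ ‖x - y‖ ≤ 4 * h) →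
      ENNReal.ofReal (|∫ y, κ y * (u x - u y)| ^ p) ≤
        ENNReal.ofReal (C * A ^ p * h ^ (s * p)) * Sx n s p u h x := by
  set V : ℝ := volume.real (ball (0 : En n) 1) with hV
  refine ⟨V ^ (p - 1) * 4 ^ ((n : ℝ) * p + s * p + s), by positivity, ?_⟩
  intro h hh u hu x κ A hA hκ hsupp
  set ann : Set (En n) := {y | h ≤ ‖x - y‖ ∧ ‖x - y‖ ≤ 4 * h} with hann
  have hannm : MeasurableSet ann := by
    have h1 : MeasurableSet {y : En n | h ≤ ‖x - y‖} := measurableSet_le (by fun_prop) (by fun_prop)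
    have h2 : MeasurableSet {y : En n | ‖x - y‖ ≤ 4 * h} := measurableSet_le (by fun_prop) (by fun_prop)
    exact h1.inter h2
  have hp0 : (0 : ℝ) ≤ p := by linarith
  have step1 : ENNReal.ofReal |∫ y, κ y * (u x - u y)| ≤
      ENNReal.ofReal (A * h ^ (-(n : ℝ))) * ∫⁻ y in ann, ENNReal.ofReal |u x - u y| := by
    calc ENNReal.ofReal |∫ y, κ y * (u x - u y)| = ‖∫ y, κ y * (u x - u y)‖ₑ := by
          rw [← Real.enorm_abs, Real.enorm_of_nonneg (abs_nonneg _)]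
      _ ≤ ∫⁻ y, ‖κ y * (u x - u y)‖ₑ := enorm_integral_le_lintegral_enorm _
      _ ≤ ∫⁻ y, ann.indicator (fun y => ENNReal.ofReal (A * h ^ (-(n : ℝ))) * ENNReal.ofReal |u x - u y|) y := by
          apply lintegral_mono
          intro y
          by_cases hy : κ y = 0
          · simp [hy]
          · dsimp only
            rw [indicator_of_mem (show y ∈ ann from hsupp y hy), ← ENNReal.ofReal_mul (by positivity),
              ← Real.enorm_abs, Real.enorm_of_nonneg (abs_nonneg _), abs_mul]
            exact ENNReal.ofReal_le_ofReal (mul_le_mul_of_nonneg_right (hκ y) (abs_nonneg _))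
      _ = _ := by
          rw [lintegral_indicator hannm, lintegral_const_mul]
          fun_prop
  have hvol : volume ann ≤ ENNReal.ofReal ((4 * h) ^ (n : ℝ) * V) := by
    have : ann ⊆ closedBall x (4 * h) := by
      intro y hy; rw [mem_closedBall, dist_comm, dist_eq_norm]; exact hy.2
    refine (measure_mono this).trans ?_
    rw [Measure.addHaar_closedBall volume x (by positivity)]
    simp only [finrank_euclideanSpace, Fintype.card_fin]
    rw [ENNReal.ofReal_mul (by positivity), Real.rpow_natCast, hV, Measure.real,
      ENNReal.ofReal_toReal measure_ball_lt_top.ne]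
  have step2 : ∫⁻ y in ann, ENNReal.ofReal |u x - u y| ^ p ≤
      ENNReal.ofReal ((4 * h) ^ ((n : ℝ) + s * p) * 4 ^ s) * Sx n s p u h x := by
    rw [Sx, ← lintegral_const_mul, ← lintegral_indicator hannm]
    · apply lintegral_mono
      intro y
      by_cases hy : y ∈ ann
      · rw [indicator_of_mem hy, ENNReal.ofReal_rpow_of_nonneg (abs_nonneg _) hp0]
        dsimp only
        rw [if_pos hy.1, ← ENNReal.ofReal_mul (by positivity)]
        apply ENNReal.ofReal_le_ofReal
        have hd : 0 < ‖x - y‖ := hh.trans_le hy.1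
        have e1 : 1 ≤ 4 ^ s * (h / ‖x - y‖) ^ s := by
          rw [← Real.mul_rpow (by norm_num) (by positivity)]
          apply Real.one_le_rpow _ hs.le
          rw [mul_div_assoc', le_div_iff₀ hd]; linarith [hy.2]
        have e2 : 1 ≤ (4 * h) ^ ((n : ℝ) + s * p) / ‖x - y‖ ^ ((n : ℝ) + s * p) := by
          rw [one_le_div (by positivity)]
          exact Real.rpow_le_rpow hd.le hy.2 (by positivity)
        unfold gP
        calc |u x - u y| ^ p ≤ |u x - u y| ^ p * (4 ^ s * (h / ‖x - y‖) ^ s) *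
              ((4 * h) ^ ((n : ℝ) + s * p) / ‖x - y‖ ^ ((n : ℝ) + s * p)) := by
              have h0 : 0 ≤ |u x - u y| ^ p := by positivity
              exact (le_mul_of_one_le_right h0 e1).trans (le_mul_of_one_le_right (by positivity) e2)
          _ = _ := by simp only; field_simp
      · rw [indicator_of_notMem hy]; exact zero_le
    · have := gP_meas n s p u hu
      apply Measurable.ennreal_ofReal
      apply Measurable.ite
      · exact measurableSet_le (by fun_prop) (by fun_prop)
      · fun_prop
      · fun_prop
  calc ENNReal.ofReal (|∫ y, κ y * (u x - u y)| ^ p)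
      = ENNReal.ofReal (|∫ y, κ y * (u x - u y)|) ^ p := by
        rw [ENNReal.ofReal_rpow_of_nonneg (abs_nonneg _) hp0]
    _ ≤ (ENNReal.ofReal (A * h ^ (-(n : ℝ))) * ∫⁻ y in ann, ENNReal.ofReal |u x - u y|) ^ p :=
        ENNReal.rpow_le_rpow step1 hp0
    _ = ENNReal.ofReal ((A * h ^ (-(n : ℝ))) ^ p) * (∫⁻ y in ann, ENNReal.ofReal |u x - u y|) ^ p := by
        rw [ENNReal.mul_rpow_of_nonneg _ _ hp0, ENNReal.ofReal_rpow_of_nonneg (by positivity) hp0]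
    _ ≤ ENNReal.ofReal ((A * h ^ (-(n : ℝ))) ^ p) * (ENNReal.ofReal (((4 * h) ^ (n : ℝ) * V) ^ (p - 1)) *
          (ENNReal.ofReal ((4 * h) ^ ((n : ℝ) + s * p) * 4 ^ s) * Sx n s p u h x)) := by
        gcongr
        refine (aux_jensen _ p hp _ (by fun_prop)).trans ?_
        gcongr
        rw [Measure.restrict_apply_univ, ← ENNReal.ofReal_rpow_of_nonneg (by positivity) (by linarith)]
        exact ENNReal.rpow_le_rpow hvol (by linarith)
    _ = _ := by
        rw [← mul_assoc, ← mul_assoc, ← ENNReal.ofReal_mul (by positivity), ← ENNReal.ofReal_mul (by positivity)]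
        congr 2
        rw [Real.mul_rpow hA (by positivity), Real.mul_rpow (by positivity) (by positivity),
          ← Real.rpow_mul hh.le, ← Real.rpow_mul (by positivity),
          Real.mul_rpow (by norm_num) hh.le, Real.mul_rpow (by norm_num) hh.le]
        have f1 : (4 : ℝ) ^ ((n : ℝ) * p + s * p + s) =
            4 ^ ((n : ℝ) * (p - 1)) * 4 ^ ((n : ℝ) + s * p) * 4 ^ s := by
          rw [← Real.rpow_add (by norm_num), ← Real.rpow_add (by norm_num)]; congr 1; ring
        have f2 : h ^ (s * p) = h ^ (-(n : ℝ) * p) * h ^ ((n : ℝ) * (p - 1)) * h ^ ((n : ℝ) + s * p) := by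
          rw [← Real.rpow_add hh, ← Real.rpow_add hh]; congr 1; ring
        rw [f1, f2]; ring

end

section


/-- Averaging by a density. -/
def avg (n : ℕ) (η m : En n → ℝ) (x : En n) : ℝ := ∫ z, η z * m (x - z)

lemma avg_int (n : ℕ) (η m : En n → ℝ) (hη : Integrable η) (hm : Measurable m) (Λ : ℝ)
    (hb : ∀ x, |m x| ≤ Λ) (x : En n) : Integrable (fun z => η z * m (x - z)) := by
  refine (hη.norm.mul_const Λ).mono' ?_ ?_
  · exact hη.aestronglyMeasurable.mul (Measurable.aestronglyMeasurable (by fun_prop))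
  · refine Filter.Eventually.of_forall fun z => ?_
    rw [norm_mul]
    exact mul_le_mul_of_nonneg_left (hb _) (norm_nonneg _)

lemma avg_meas (n : ℕ) (η m : En n → ℝ) (hη : Continuous η) (hm : Measurable m) :
    Measurable (avg n η m) := by
  have : StronglyMeasurable (fun w : En n × En n => η w.2 * m (w.1 - w.2)) := by
    apply Measurable.stronglyMeasurable
    have := hη.measurable
    fun_prop
  exact (this.integral_prod_right (ν := volume)).measurable

lemma avg_bound (n : ℕ) (η m : En n → ℝ) (hη0 : ∀ w, 0 ≤ η w)
    (hi : Integrable η) (h1 : ∫ w, η w = 1) (Λ : ℝ)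
    (hb : ∀ x, |m x| ≤ Λ) (x : En n) : |avg n η m x| ≤ Λ := by
  have := norm_integral_le_of_norm_le (f := fun z => η z * m (x - z)) (hi.mul_const Λ)
    (Filter.Eventually.of_forall fun z => by
      rw [norm_mul, Real.norm_of_nonneg (hη0 z)]
      exact mul_le_mul_of_nonneg_left (hb _) (hη0 z))
  rw [integral_mul_const, h1, one_mul] at this
  exact this

lemma avg_eq (n : ℕ) (η m : En n → ℝ) (x : En n) :
    avg n η m x = ∫ y, η (x - y) * m y := by
  rw [avg, ← integral_sub_left_eq_self _ volume x]
  simp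

lemma avg_sub (n : ℕ) (η m : En n → ℝ)
    (hi : Integrable η) (h1 : ∫ w, η w = 1) (hm : Measurable m) (Λ : ℝ)
    (hb : ∀ x, |m x| ≤ Λ) (c : ℝ) (x : En n) :
    c - avg n η m x = ∫ y, η (x - y) * (c - m y) := by
  have e : ∫ y, η (x - y) * (c - m y) = ∫ z, η z * (c - m (x - z)) := by
    rw [← integral_sub_left_eq_self _ volume x]; simp
  rw [e]
  simp_rw [mul_sub]
  rw [integral_sub (hi.mul_const c) (avg_int n η m hi hm Λ hb x), integral_mul_const, h1, one_mul, avg]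

lemma avg_gP (n : ℕ) (s p : ℝ) (hp : 1 < p) (η m : En n → ℝ) (hc : Continuous η)
    (hη0 : ∀ w, 0 ≤ η w)
    (hi : Integrable η) (h1 : ∫ w, η w = 1) (hm : Measurable m) (Λ : ℝ)
    (hb : ∀ x, |m x| ≤ Λ) (w : En n × En n) :
    ENNReal.ofReal (gP n s p (avg n η m) w) ≤
      ∫⁻ z, ENNReal.ofReal (η z) * ENNReal.ofReal (gP n s p m (w - (z, z))) := by
  have hηm := hc.measurable
  have hp0 : (0 : ℝ) ≤ p := by linarith
  have hmass : (volume.withDensity fun z => ENNReal.ofReal (η z)) univ = 1 := by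
    rw [withDensity_apply _ MeasurableSet.univ, Measure.restrict_univ,
      ← ofReal_integral_eq_lintegral_ofReal hi (Filter.Eventually.of_forall hη0), h1]
    simp
  have hd : avg n η m w.1 - avg n η m w.2 = ∫ z, η z * (m (w.1 - z) - m (w.2 - z)) := by
    simp_rw [mul_sub]
    rw [integral_sub (avg_int n η m hi hm Λ hb _) (avg_int n η m hi hm Λ hb _)]; rfl
  have step1 : ENNReal.ofReal |avg n η m w.1 - avg n η m w.2| ≤
      ∫⁻ z, ENNReal.ofReal |m (w.1 - z) - m (w.2 - z)| ∂(volume.withDensity fun z => ENNReal.ofReal (η z)) := by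
    rw [hd, lintegral_withDensity_eq_lintegral_mul _ (by fun_prop) (by fun_prop)]
    calc _ = ‖∫ z, η z * (m (w.1 - z) - m (w.2 - z))‖ₑ := by
          rw [← Real.enorm_abs, Real.enorm_of_nonneg (abs_nonneg _)]
      _ ≤ _ := enorm_integral_le_lintegral_enorm _
      _ = _ := by
          congr 1; ext z
          rw [← Real.enorm_abs, Real.enorm_of_nonneg (abs_nonneg _), abs_mul, abs_of_nonneg (hη0 z),
            ENNReal.ofReal_mul (hη0 z)]; rfl
  have step2 : ENNReal.ofReal (|avg n η m w.1 - avg n η m w.2| ^ p) ≤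
      ∫⁻ z, ENNReal.ofReal (η z) * ENNReal.ofReal (|m (w.1 - z) - m (w.2 - z)| ^ p) := by
    rw [← ENNReal.ofReal_rpow_of_nonneg (abs_nonneg _) hp0]
    refine (ENNReal.rpow_le_rpow step1 hp0).trans ?_
    refine (aux_jensen _ p hp _ (by fun_prop)).trans ?_
    rw [hmass, ENNReal.one_rpow, one_mul, lintegral_withDensity_eq_lintegral_mul _ (by fun_prop) (by fun_prop)]
    apply lintegral_mono
    intro z
    simp only [Pi.mul_apply]
    rw [ENNReal.ofReal_rpow_of_nonneg (abs_nonneg _) hp0]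
  have e1 : ENNReal.ofReal (gP n s p (avg n η m) w) =
      ENNReal.ofReal ((‖w.1 - w.2‖ ^ ((n : ℝ) + s * p))⁻¹) * ENNReal.ofReal (|avg n η m w.1 - avg n η m w.2| ^ p) := by
    rw [← ENNReal.ofReal_mul (by positivity)]; congr 1; unfold gP; rw [div_eq_mul_inv, mul_comm]
  rw [e1]
  refine (mul_le_mul_right step2 _).trans ?_
  rw [← lintegral_const_mul _ (by fun_prop)]
  apply le_of_eq
  congr 1; ext z
  rw [mul_left_comm, ← ENNReal.ofReal_mul (by positivity)]
  congr 2
  unfold gP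
  simp only [Prod.fst_sub, Prod.snd_sub, sub_sub_sub_cancel_right]
  rw [div_eq_mul_inv, mul_comm]

lemma avg_contract (n : ℕ) (s p : ℝ) (hp : 1 < p) (η m : En n → ℝ) (hc : Continuous η)
    (hη0 : ∀ w, 0 ≤ η w)
    (hi : Integrable η) (h1 : ∫ w, η w = 1) (hm : Measurable m) (Λ : ℝ)
    (hb : ∀ x, |m x| ≤ Λ) :
    ∫⁻ w, ENNReal.ofReal (gP n s p (avg n η m) w) ≤ ∫⁻ w, ENNReal.ofReal (gP n s p m w) := by
  have hηm := hc.measurable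
  have hg := gP_meas n s p m hm
  refine (lintegral_mono (fun w => avg_gP n s p hp η m hc hη0 hi h1 hm Λ hb w)).trans ?_
  rw [lintegral_lintegral_swap]
  · have : ∀ z : En n, ∫⁻ w : En n × En n, ENNReal.ofReal (η z) * ENNReal.ofReal (gP n s p m (w - (z, z)))
        = ENNReal.ofReal (η z) * ∫⁻ w, ENNReal.ofReal (gP n s p m w) := by
      intro z
      rw [lintegral_const_mul _ (by fun_prop)]
      congr 1
      exact lintegral_sub_right_eq_self (μ := ((volume : Measure (En n)).prod (volume : Measure (En n))))
        (fun w => ENNReal.ofReal (gP n s p m w)) (z, z)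
    simp_rw [this]
    rw [lintegral_mul_const _ (by fun_prop),
      ← ofReal_integral_eq_lintegral_ofReal hi (Filter.Eventually.of_forall hη0), h1]
    simp
  · apply Measurable.aemeasurable
    refine Measurable.mul (f := fun q : (En n × En n) × En n => ENNReal.ofReal (η q.2))
      (g := fun q => ENNReal.ofReal (gP n s p m (q.1 - (q.2, q.2)))) ?_ ?_
    · fun_prop
    · apply Measurable.ennreal_ofReal
      apply hg.comp
      fun_prop

end

section
open Filter Topology


lemma prod_left {n : ℕ} (k : En n × En n → ℝ≥0∞) (hk : Measurable k) (C : ℝ≥0∞)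
    (hC : ∀ x, ∫⁻ y, k (x, y) ≤ C) (w : En n → ℝ≥0∞) (hw : Measurable w) :
    ∫⁻ z : En n × En n, k z * w z.1 ≤ C * ∫⁻ x, w x := by
  rw [Measure.volume_eq_prod, lintegral_prod _ (by fun_prop)]
  rw [← lintegral_const_mul _ hw]
  apply lintegral_mono
  intro x
  dsimp only
  rw [lintegral_mul_const _ (by fun_prop)]
  gcongr
  exact hC x

lemma swap_lint {n : ℕ} (F : En n × En n → ℝ≥0∞) :
    ∫⁻ z : En n × En n, F z.swap = ∫⁻ z, F z := by
  rw [Measure.volume_eq_prod]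
  exact lintegral_prod_swap F

lemma prod_right {n : ℕ} (k : En n × En n → ℝ≥0∞) (hk : Measurable k) (C : ℝ≥0∞)
    (hsym : ∀ z, k z.swap = k z)
    (hC : ∀ x, ∫⁻ y, k (x, y) ≤ C) (w : En n → ℝ≥0∞) (hw : Measurable w) :
    ∫⁻ z : En n × En n, k z * w z.2 ≤ C * ∫⁻ x, w x := by
  rw [← swap_lint]
  simp_rw [hsym, Prod.snd_swap]
  exact prod_left k hk C hC w hw

/-- Far kernel. -/
def Jk (n : ℕ) (β h : ℝ) (z : En n × En n) : ℝ :=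
  if h ≤ ‖z.1 - z.2‖ then ‖z.1 - z.2‖ ^ (-((n : ℝ) + β)) else 0

lemma Jk_nonneg (n : ℕ) (β h : ℝ) (z : En n × En n) : 0 ≤ Jk n β h z := by
  unfold Jk; split_ifs <;> positivity

lemma Jk_meas (n : ℕ) (β h : ℝ) : Measurable (Jk n β h) := by
  unfold Jk
  refine Measurable.ite (measurableSet_le (by fun_prop) (by fun_prop)) (by fun_prop) (by fun_prop)

lemma Jk_swap (n : ℕ) (β h : ℝ) (z : En n × En n) : Jk n β h z.swap = Jk n β h z := by
  unfold Jk; simp [norm_sub_rev]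

/-- Total coefficient. -/
def cf (n : ℕ) (p q s t : ℝ) (a : En n × En n → ℝ) (u : En n → ℝ) (z : En n × En n) : ℝ :=
  1 / ‖z.1 - z.2‖ ^ ((n : ℝ) + s * p)
    + a z * |u z.1 - u z.2| ^ (q - p) / ‖z.1 - z.2‖ ^ ((n : ℝ) + t * q)

lemma form_eq (n : ℕ) (p q s t : ℝ) (a : En n × En n → ℝ) (u φ : En n → ℝ) (z : En n × En n) :
    formIntegrand n p q s t a u φ z = cf n p q s t a u z *
      (|u z.1 - u z.2| ^ (p - 2) * (u z.1 - u z.2)) * (φ z.1 - φ z.2) := by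
  unfold formIntegrand cf
  by_cases h : u z.1 - u z.2 = 0
  · simp [h]
  · have h0 : 0 < |u z.1 - u z.2| := abs_pos.2 h
    have : |u z.1 - u z.2| ^ (q - 2) = |u z.1 - u z.2| ^ (q - p) * |u z.1 - u z.2| ^ (p - 2) := by
      rw [← Real.rpow_add h0]; congr 1; ring
    rw [this]; ring

lemma abs_pow_eq (p r : ℝ) (hp : 1 < p) : |(|r| ^ (p - 2) * r)| = |r| ^ (p - 1) := by
  by_cases h : r = 0
  · subst h; simp; rw [Real.zero_rpow (by linarith)]
  · have h0 : 0 < |r| := abs_pos.2 h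
    rw [abs_mul, abs_of_nonneg (by positivity : 0 ≤ |r| ^ (p - 2)), ← Real.rpow_add_one h0.ne']
    congr 1; ring

lemma pow_mul_eq (p r : ℝ) (hp : 1 < p) : (|r| ^ (p - 2) * r) * r = |r| ^ p := by
  by_cases h : r = 0
  · subst h; simp; rw [Real.zero_rpow (by linarith)]
  · have h0 : 0 < |r| := abs_pos.2 h
    have : |r| ^ p = |r| ^ (p - 2) * |r| ^ (2 : ℝ) := by
      rw [← Real.rpow_add h0]; congr 1; ring
    rw [this, Real.rpow_two, sq_abs]; ring

section
variable (n : ℕ) (p q s t M Λ : ℝ) (a : En n × En n → ℝ) (u : En n → ℝ)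

lemma cf_lower (ha0 : ∀ z, 0 ≤ a z) (z : En n × En n) :
    1 / ‖z.1 - z.2‖ ^ ((n : ℝ) + s * p) ≤ cf n p q s t a u z := by
  have := ha0 z
  unfold cf
  have : 0 ≤ a z * |u z.1 - u z.2| ^ (q - p) / ‖z.1 - z.2‖ ^ ((n : ℝ) + t * q) := by positivity
  linarith

lemma cf_upper (hn : 2 ≤ n) (ht0 : 0 < t) (hq : 0 < q) (hpq : p ≤ q) (hle : t * q ≤ s * p)
    (ha0 : ∀ z, 0 ≤ a z) (haM : ∀ z, a z ≤ M) (hub : ∀ x, |u x| ≤ Λ) (z : En n × En n) :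
    cf n p q s t a u z ≤ (1 + M * (2 * Λ) ^ (q - p)) * (1 / ‖z.1 - z.2‖ ^ ((n : ℝ) + s * p))
      + M * (2 * Λ) ^ (q - p) * Jk n (t * q) 1 z := by
  have hM : 0 ≤ M := (ha0 z).trans (haM z)
  have hΛ : 0 ≤ Λ := (abs_nonneg _).trans (hub 0)
  have hU : |u z.1 - u z.2| ≤ 2 * Λ := by
    have := abs_sub (u z.1) (u z.2); have := hub z.1; have := hub z.2; linarith
  have hc : a z * |u z.1 - u z.2| ^ (q - p) ≤ M * (2 * Λ) ^ (q - p) := by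
    have := Real.rpow_le_rpow (abs_nonneg _) hU (sub_nonneg.2 hpq)
    exact mul_le_mul (haM z) this (by positivity) hM
  have hc0 : 0 ≤ M * (2 * Λ) ^ (q - p) := by positivity
  have hn' : (0 : ℝ) < n := by exact_mod_cast (by omega : 0 < n)
  unfold cf Jk
  set d := ‖z.1 - z.2‖ with hd
  have hd0 : 0 ≤ d := norm_nonneg _
  by_cases h : 1 ≤ d
  · rw [if_pos h, Real.rpow_neg hd0]
    have e1 : a z * |u z.1 - u z.2| ^ (q - p) / d ^ ((n : ℝ) + t * q) ≤
        M * (2 * Λ) ^ (q - p) * (d ^ ((n : ℝ) + t * q))⁻¹ := by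
      rw [div_eq_mul_inv]; gcongr
    have e2 : 0 ≤ M * (2 * Λ) ^ (q - p) * (1 / d ^ ((n : ℝ) + s * p)) := by positivity
    linarith
  · rw [if_neg h]
    push Not at h
    rcases hd0.eq_or_lt with h0 | h0
    · rw [← h0, Real.zero_rpow (by nlinarith [mul_pos ht0 hq]), Real.zero_rpow (by nlinarith [mul_pos ht0 hq])]; simp
    · have e3 : d ^ ((n : ℝ) + s * p) ≤ d ^ ((n : ℝ) + t * q) :=
        Real.rpow_le_rpow_of_exponent_ge h0 h.le (by linarith)
      have e1 : a z * |u z.1 - u z.2| ^ (q - p) / d ^ ((n : ℝ) + t * q) ≤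
        M * (2 * Λ) ^ (q - p) / d ^ ((n : ℝ) + s * p) := by
        gcongr
      have : M * (2 * Λ) ^ (q - p) / d ^ ((n : ℝ) + s * p) =
        M * (2 * Λ) ^ (q - p) * (1 / d ^ ((n : ℝ) + s * p)) := by ring
      linarith

lemma cf_meas (ha : Measurable a) (hu : Measurable u) : Measurable (cf n p q s t a u) := by
  unfold cf; fun_prop

lemma form_meas (ha : Measurable a) (hu : Measurable u) (φ : En n → ℝ) (hφ : Measurable φ) :
    Measurable (formIntegrand n p q s t a u φ) := by
  unfold formIntegrand; fun_prop

/-- Basic upper bound for the form integrand. -/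
lemma form_abs (hn : 2 ≤ n) (ht0 : 0 < t) (hp : 1 < p) (hpq : p ≤ q) (hle : t * q ≤ s * p)
    (ha0 : ∀ z, 0 ≤ a z) (haM : ∀ z, a z ≤ M) (hub : ∀ x, |u x| ≤ Λ) (φ : En n → ℝ)
    (z : En n × En n) :
    |formIntegrand n p q s t a u φ z| ≤
      (1 + M * (2 * Λ) ^ (q - p)) * (|u z.1 - u z.2| ^ (p - 1) * |φ z.1 - φ z.2|
        / ‖z.1 - z.2‖ ^ ((n : ℝ) + s * p))
      + M * (2 * Λ) ^ (q - p) * (2 * Λ) ^ (p - 1) * (Jk n (t * q) 1 z * (|φ z.1| + |φ z.2|)) := by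
  have hM : 0 ≤ M := (ha0 z).trans (haM z)
  have hΛ : 0 ≤ Λ := (abs_nonneg _).trans (hub 0)
  have hU : |u z.1 - u z.2| ≤ 2 * Λ := by
    have := abs_sub (u z.1) (u z.2); have := hub z.1; have := hub z.2; linarith
  have h1 := cf_upper n p q s t M Λ a u hn ht0 (by linarith) hpq hle ha0 haM hub z
  have h0 : 0 ≤ cf n p q s t a u z := le_trans (by positivity) (cf_lower n p q s t a u ha0 z)
  rw [form_eq, abs_mul, abs_mul, abs_pow_eq p _ hp, abs_of_nonneg h0]
  have hUp : |u z.1 - u z.2| ^ (p - 1) ≤ (2 * Λ) ^ (p - 1) :=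
    Real.rpow_le_rpow (abs_nonneg _) hU (by linarith)
  have hφ : |φ z.1 - φ z.2| ≤ |φ z.1| + |φ z.2| := abs_sub _ _
  have hJ := Jk_nonneg n (t * q) 1 z
  have hX : |u z.1 - u z.2| ^ (p - 1) * |φ z.1 - φ z.2| ≤ (2 * Λ) ^ (p - 1) * (|φ z.1| + |φ z.2|) := by
    gcongr
  have hX0 : 0 ≤ |u z.1 - u z.2| ^ (p - 1) * |φ z.1 - φ z.2| := by positivity
  calc _ = cf n p q s t a u z * (|u z.1 - u z.2| ^ (p - 1) * |φ z.1 - φ z.2|) := by ring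
    _ ≤ ((1 + M * (2 * Λ) ^ (q - p)) * (1 / ‖z.1 - z.2‖ ^ ((n : ℝ) + s * p))
      + M * (2 * Λ) ^ (q - p) * Jk n (t * q) 1 z) * (|u z.1 - u z.2| ^ (p - 1) * |φ z.1 - φ z.2|) := by
        gcongr
    _ = (1 + M * (2 * Λ) ^ (q - p)) * (|u z.1 - u z.2| ^ (p - 1) * |φ z.1 - φ z.2|
        / ‖z.1 - z.2‖ ^ ((n : ℝ) + s * p)) + M * (2 * Λ) ^ (q - p) * Jk n (t * q) 1 z * (|u z.1 - u z.2| ^ (p - 1) * |φ z.1 - φ z.2|) := by ring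
    _ ≤ (1 + M * (2 * Λ) ^ (q - p)) * (|u z.1 - u z.2| ^ (p - 1) * |φ z.1 - φ z.2|
        / ‖z.1 - z.2‖ ^ ((n : ℝ) + s * p)) + M * (2 * Λ) ^ (q - p) * Jk n (t * q) 1 z * ((2 * Λ) ^ (p - 1) * (|φ z.1| + |φ z.2|)) := by
        gcongr
    _ = _ := by ring
end

end

section
open Filter Topology


lemma int_of_lint {α : Type*} [MeasurableSpace α] {μ : Measure α} {g : α → ℝ} (hg : Measurable g)
    (h0 : ∀ x, 0 ≤ g x) (h : ∫⁻ x, ENNReal.ofReal (g x) ∂μ < ⊤) : Integrable g μ :=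
  (lintegral_ofReal_ne_top_iff_integrable hg.aestronglyMeasurable (Eventually.of_forall h0)).1 h.ne

lemma J_lint (n : ℕ) (hn : 2 ≤ n) (β : ℝ) (hβ : 0 < β) : ∃ C : ℝ, 0 ≤ C ∧
    ∀ w : En n → ℝ, Measurable w → (∀ x, 0 ≤ w x) →
      ∫⁻ z, ENNReal.ofReal (Jk n β 1 z * (w z.1 + w z.2)) ≤
        ENNReal.ofReal C * ∫⁻ x, ENNReal.ofReal (w x) := by
  obtain ⟨C, hC0, hC⟩ := rad_out n hn β hβ
  refine ⟨2 * C, by positivity, fun w hw hw0 => ?_⟩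
  have hJ := Jk_meas n β 1
  have h1 := fun x => hC 1 one_pos x
  simp only [Real.one_rpow, mul_one] at h1
  have e : ∀ z : En n × En n, ENNReal.ofReal (Jk n β 1 z * (w z.1 + w z.2)) =
      ENNReal.ofReal (Jk n β 1 z) * ENNReal.ofReal (w z.1)
        + ENNReal.ofReal (Jk n β 1 z) * ENNReal.ofReal (w z.2) := by
    intro z
    rw [ENNReal.ofReal_mul (Jk_nonneg _ _ _ _), ENNReal.ofReal_add (hw0 _) (hw0 _), mul_add]
  simp_rw [e]
  rw [lintegral_add_left (by fun_prop)]
  have h2 := prod_left (fun z => ENNReal.ofReal (Jk n β 1 z)) (by fun_prop) _ h1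
    (fun x => ENNReal.ofReal (w x)) (by fun_prop)
  have h3 := prod_right (fun z => ENNReal.ofReal (Jk n β 1 z)) (by fun_prop) _
    (fun z => by rw [Jk_swap]) h1 (fun x => ENNReal.ofReal (w x)) (by fun_prop)
  refine (add_le_add h2 h3).trans (le_of_eq ?_)
  rw [← two_mul, ← mul_assoc, ENNReal.ofReal_mul (by norm_num)]
  norm_num

lemma weak_ext (n : ℕ) (p q s t M Λ : ℝ) (a : En n × En n → ℝ) (u f : En n → ℝ)
    (hn : 2 ≤ n) (ht0 : 0 < t) (hp : 1 < p) (hpq : p ≤ q) (hle : t * q ≤ s * p)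
    (ha : Measurable a)
    (ha0 : ∀ z, 0 ≤ a z) (haM : ∀ z, a z ≤ M) (hub : ∀ x, |u x| ≤ Λ) (hu : Measurable u)
    (huE : ∫⁻ z, ENNReal.ofReal (gP n s p u z) < ⊤)
    (hf : Measurable f) (hfi : ∀ R, IntegrableOn f (closedBall 0 R))
    (hsol : ∀ φ : En n → ℝ, ContDiff ℝ (⊤ : ℕ∞) φ → HasCompactSupport φ →
      (∫ z : En n × En n, formIntegrand n p q s t a u φ z) = ∫ x, f x * φ x)
    (φ : En n → ℝ) (hφ : Measurable φ) (B R : ℝ) (hB : ∀ x, |φ x| ≤ B)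
    (hR : ∀ x, R < ‖x‖ → φ x = 0) (hφE : ∫⁻ z, ENNReal.ofReal (gP n s p φ z) < ⊤) :
    Integrable (formIntegrand n p q s t a u φ) ∧
      ∫ z, formIntegrand n p q s t a u φ z ≤ ∫ x, f x * φ x := by
  have hM : 0 ≤ M := (ha0 0).trans (haM 0)
  have hΛ : 0 ≤ Λ := (abs_nonneg _).trans (hub 0)
  have hB0 : 0 ≤ B := (abs_nonneg _).trans (hB 0)
  set L := 1 + M * (2 * Λ) ^ (q - p) with hL
  have hL0 : 0 ≤ L := by positivity
  set M2 := M * (2 * Λ) ^ (q - p) * (2 * Λ) ^ (p - 1) with hM2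
  have hM20 : 0 ≤ M2 := by positivity
  set w : En n → ℝ := (closedBall 0 (R + 1)).indicator (fun _ => B) with hw
  have hwm : Measurable w := measurable_const.indicator measurableSet_closedBall
  have hw0 : ∀ x, 0 ≤ w x := fun x => indicator_nonneg (fun _ _ => hB0) x
  have hwi : ∫⁻ x, ENNReal.ofReal (w x) < ⊤ := by
    have : Integrable w := (integrable_indicator_iff measurableSet_closedBall).2
      (integrableOn_const (measure_closedBall_lt_top).ne)
    exact (hasFiniteIntegral_iff_ofReal (Eventually.of_forall hw0)).1 this.2
  obtain ⟨CJ, -, hCJ⟩ := J_lint n hn (t * q) (by nlinarith)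
  have hJm := Jk_meas n (t * q) 1
  have hJi : Integrable (fun z : En n × En n => Jk n (t * q) 1 z * (w z.1 + w z.2)) :=
    int_of_lint (by fun_prop)
      (fun z => mul_nonneg (Jk_nonneg _ _ _ _) (add_nonneg (hw0 _) (hw0 _)))
      ((hCJ w hwm hw0).trans_lt (ENNReal.mul_lt_top ENNReal.ofReal_lt_top hwi))
  have hgu : Integrable (gP n s p u) := int_of_lint (gP_meas n s p u hu) (gP_nonneg n s p u) huE
  set H : En n × En n → ℝ := fun z => L * gP n s p u z + M2 * (Jk n (t * q) 1 z * (w z.1 + w z.2)) with hH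
  have hHi : Integrable H := (hgu.const_mul L).add (hJi.const_mul M2)
  -- general bound
  have gen : ∀ χ : En n → ℝ, (∀ x, |χ x| ≤ w x) → ∀ z,
      |formIntegrand n p q s t a u χ z| ≤ H z + L * gP n s p χ z := by
    intro χ hχ z
    refine (form_abs n p q s t M Λ a u hn ht0 hp hpq hle ha0 haM hub χ z).trans ?_
    have h1 : |u z.1 - u z.2| ^ (p - 1) * |χ z.1 - χ z.2| / ‖z.1 - z.2‖ ^ ((n : ℝ) + s * p)
        ≤ gP n s p u z + gP n s p χ z := by
      unfold gP
      rw [← add_div]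
      gcongr
      have := aux_young p 1 |u z.1 - u z.2| |χ z.1 - χ z.2| hp.le one_pos (abs_nonneg _) (abs_nonneg _)
      simpa using this
    have h2 : Jk n (t * q) 1 z * (|χ z.1| + |χ z.2|) ≤ Jk n (t * q) 1 z * (w z.1 + w z.2) :=
      mul_le_mul_of_nonneg_left (add_le_add (hχ _) (hχ _)) (Jk_nonneg _ _ _ _)
    have h3 := mul_le_mul_of_nonneg_left h1 hL0
    have h4 := mul_le_mul_of_nonneg_left h2 hM20
    simp only [hH]
    linarith
  have genint : ∀ χ : En n → ℝ, Measurable χ → (∀ x, |χ x| ≤ w x) → Integrable (gP n s p χ) →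
      Integrable (formIntegrand n p q s t a u χ) := by
    intro χ hχm hχ hi
    exact (hHi.add (hi.const_mul L)).mono' (form_meas n p q s t a u ha hu χ hχm).aestronglyMeasurable
      (Eventually.of_forall fun z => by simpa using gen χ hχ z)
  have hφw : ∀ x, |φ x| ≤ w x := by
    intro x
    by_cases hx : R < ‖x‖
    · rw [hR x hx, abs_zero]; exact hw0 x
    · have : x ∈ closedBall (0 : En n) (R + 1) := by simp; linarith
      rw [hw, indicator_of_mem this]; exact hB x
  have hgφ : Integrable (gP n s p φ) := int_of_lint (gP_meas n s p φ hφ) (gP_nonneg n s p φ) hφE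
  have hφint := genint φ hφ hφw hgφ
  refine ⟨hφint, ?_⟩
  -- mollification
  let b : ℕ → ContDiffBump (0 : En n) := fun k =>
    ⟨(1 / ((k : ℝ) + 1)) / 2, 1 / ((k : ℝ) + 1), by positivity, by
      have : 0 < 1 / ((k : ℝ) + 1) := by positivity
      linarith⟩
  let φk : ℕ → En n → ℝ := fun k => avg n ((b k).normed volume) φ
  have hφloc : LocallyIntegrable φ := by
    have : Integrable φ := by
      refine (int_of_lint hwm hw0 hwi).mono' hφ.aestronglyMeasurable (Eventually.of_forall fun x => ?_)
      exact hφw x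
    exact this.locallyIntegrable
  have hconv : ∀ k, φk k = MeasureTheory.convolution ((b k).normed volume) φ (ContinuousLinearMap.lsmul ℝ ℝ) volume := by
    intro k; ext x; rfl
  have hae : ∀ᵐ x, Tendsto (fun k => φk k x) atTop (𝓝 (φ x)) := by
    have := ContDiffBump.ae_convolution_tendsto_right_of_locallyIntegrable (μ := (volume : Measure (En n)))
      (φ := b) (l := atTop) (K := 2) (g := φ)
      (by exact tendsto_one_div_add_atTop_nhds_zero_nat)
      (Eventually.of_forall fun k => by show 1 / ((k : ℝ) + 1) ≤ 2 * ((1 / ((k : ℝ) + 1)) / 2); linarith) hφloc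
    filter_upwards [this] with x hx
    simpa only [hconv] using hx
  have hφkm : ∀ k, Measurable (φk k) := fun k => avg_meas n _ φ (b k).continuous_normed hφ
  have hφkz : ∀ k x, R + 1 < ‖x‖ → φk k x = 0 := by
    intro k x hx
    show ∫ z, (b k).normed volume z * φ (x - z) = 0
    apply integral_eq_zero_of_ae
    refine Eventually.of_forall fun z => ?_
    by_cases hz : (b k).normed volume z = 0
    · simp [hz]
    · have : z ∈ Function.support ((b k).normed volume) := hz
      rw [ContDiffBump.support_normed_eq, mem_ball_zero_iff] at this
      have h1 : (b k).rOut ≤ 1 := by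
        show 1 / ((k : ℝ) + 1) ≤ 1
        rw [div_le_one (by positivity)]; have : (0 : ℝ) ≤ k := Nat.cast_nonneg k
        linarith
      have h2 := norm_sub_norm_le x z
      simp [hR (x - z) (by linarith)]
  have hφkw : ∀ k x, |φk k x| ≤ w x := by
    intro k x
    by_cases hx : R + 1 < ‖x‖
    · rw [hφkz k x hx, abs_zero]; exact hw0 x
    · have : x ∈ closedBall (0 : En n) (R + 1) := by simp; linarith
      rw [hw, indicator_of_mem this]
      exact avg_bound n _ φ (b k).nonneg_normed (b k).integrable_normed (b k).integral_normed B hB x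
  have hcontr : ∀ k, ∫⁻ z, ENNReal.ofReal (gP n s p (φk k) z) ≤ ∫⁻ z, ENNReal.ofReal (gP n s p φ z) :=
    fun k => avg_contract n s p hp _ φ (b k).continuous_normed (b k).nonneg_normed
      (b k).integrable_normed (b k).integral_normed hφ B hB
  have hgk : ∀ k, Integrable (gP n s p (φk k)) := fun k =>
    int_of_lint (gP_meas n s p _ (hφkm k)) (gP_nonneg n s p _) ((hcontr k).trans_lt hφE)
  have hcontr' : ∀ k, ∫ z, gP n s p (φk k) z ≤ ∫ z, gP n s p φ z := by
    intro k
    have h1 := ofReal_integral_eq_lintegral_ofReal (hgk k) (Eventually.of_forall (gP_nonneg n s p (φk k)))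
    have h2 := ofReal_integral_eq_lintegral_ofReal hgφ (Eventually.of_forall (gP_nonneg n s p φ))
    have h3 := hcontr k
    rw [← h1, ← h2] at h3
    exact (ENNReal.ofReal_le_ofReal_iff (integral_nonneg (gP_nonneg n s p φ))).1 h3
  have hkint : ∀ k, Integrable (formIntegrand n p q s t a u (φk k)) := fun k =>
    genint _ (hφkm k) (hφkw k) (hgk k)
  have hkeq : ∀ k, ∫ z, formIntegrand n p q s t a u (φk k) z = ∫ x, f x * φk k x := by
    intro k
    apply hsol
    · rw [hconv k]
      exact (b k).hasCompactSupport_normed.contDiff_convolution_left _ (b k).contDiff_normed hφloc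
    · refine HasCompactSupport.intro (isCompact_closedBall (0 : En n) (R + 1)) fun x hx => ?_
      apply hφkz k x
      simpa using hx
  have hftend : Tendsto (fun k => ∫ x, f x * φk k x) atTop (𝓝 (∫ x, f x * φ x)) := by
    apply tendsto_integral_of_dominated_convergence (fun x => (closedBall 0 (R + 1)).indicator (fun x => ‖f x‖ * B) x)
    · intro k; have := hφkm k
      exact Measurable.aestronglyMeasurable (by fun_prop)
    · rw [integrable_indicator_iff measurableSet_closedBall]
      exact (hfi (R + 1)).norm.mul_const B
    · intro k
      refine Eventually.of_forall fun x => ?_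
      by_cases hx : x ∈ closedBall (0 : En n) (R + 1)
      · rw [indicator_of_mem hx, norm_mul]
        have := hφkw k x
        rw [hw, indicator_of_mem hx] at this
        exact mul_le_mul_of_nonneg_left this (norm_nonneg _)
      · have := hφkw k x
        rw [hw, indicator_of_notMem hx] at this
        have : φk k x = 0 := abs_eq_zero.1 (le_antisymm this (abs_nonneg _))
        rw [indicator_of_notMem hx, this]; simp
    · filter_upwards [hae] with x hx
      exact hx.const_mul _
  -- Fatou
  set G : ℕ → En n × En n → ℝ := fun k z => formIntegrand n p q s t a u (φk k) z + (H z + L * gP n s p (φk k) z) with hG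
  set G0 : En n × En n → ℝ := fun z => formIntegrand n p q s t a u φ z + (H z + L * gP n s p φ z) with hG0
  have hGnn : ∀ k z, 0 ≤ G k z := fun k z => by
    have := gen (φk k) (hφkw k) z
    have := neg_abs_le (formIntegrand n p q s t a u (φk k) z)
    simp only [hG]; linarith
  have hG0nn : ∀ z, 0 ≤ G0 z := fun z => by
    have := gen φ hφw z
    have := neg_abs_le (formIntegrand n p q s t a u φ z)
    simp only [hG0]; linarith
  have hGi : ∀ k, Integrable (G k) := fun k => (hkint k).add (hHi.add ((hgk k).const_mul L))
  have hG0i : Integrable G0 := hφint.add (hHi.add (hgφ.const_mul L))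
  have hGint : ∀ k, ∫ z, G k z = (∫ x, f x * φk k x) + ((∫ z, H z) + L * ∫ z, gP n s p (φk k) z) := by
    intro k
    simp only [hG]
    rw [integral_add (hkint k) (show Integrable (fun z => H z + L * gP n s p (φk k) z) from hHi.add ((hgk k).const_mul L)), hkeq k, integral_add hHi ((hgk k).const_mul L),
      integral_const_mul]
  have hG0int : ∫ z, G0 z = (∫ z, formIntegrand n p q s t a u φ z) + ((∫ z, H z) + L * ∫ z, gP n s p φ z) := by
    simp only [hG0]
    rw [integral_add hφint (show Integrable (fun z => H z + L * gP n s p φ z) from hHi.add (hgφ.const_mul L)), integral_add hHi (hgφ.const_mul L),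
      integral_const_mul]
  have hGle : ∀ k, ∫ z, G k z ≤ (∫ x, f x * φk k x) + ((∫ z, H z) + L * ∫ z, gP n s p φ z) := by
    intro k
    rw [hGint k]
    have := mul_le_mul_of_nonneg_left (hcontr' k) hL0
    linarith
  have htend : ∀ᵐ z : En n × En n, Tendsto (fun k => ENNReal.ofReal (G k z)) atTop (𝓝 (ENNReal.ofReal (G0 z))) := by
    have h1 : ∀ᵐ z : En n × En n, Tendsto (fun k => φk k z.1) atTop (𝓝 (φ z.1)) := by
      rw [Measure.volume_eq_prod]
      exact Measure.quasiMeasurePreserving_fst.ae hae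
    have h2 : ∀ᵐ z : En n × En n, Tendsto (fun k => φk k z.2) atTop (𝓝 (φ z.2)) := by
      rw [Measure.volume_eq_prod]
      exact Measure.quasiMeasurePreserving_snd.ae hae
    filter_upwards [h1, h2] with z hz1 hz2
    apply ENNReal.tendsto_ofReal
    have hd := hz1.sub hz2
    apply Tendsto.add
    · simp_rw [form_eq]
      exact hd.const_mul _
    · apply Tendsto.const_add
      apply Tendsto.const_mul
      unfold gP
      apply Tendsto.div_const
      exact hd.abs.rpow_const (Or.inr (by linarith))
  have hrt : Tendsto (fun k => (∫ x, f x * φk k x) + ((∫ z, H z) + L * ∫ z, gP n s p φ z)) atTop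
      (𝓝 ((∫ x, f x * φ x) + ((∫ z, H z) + L * ∫ z, gP n s p φ z))) := hftend.add_const _
  have hrnn : 0 ≤ (∫ x, f x * φ x) + ((∫ z, H z) + L * ∫ z, gP n s p φ z) :=
    ge_of_tendsto hrt (Eventually.of_forall fun k => (integral_nonneg (hGnn k)).trans (hGle k))
  have fatou : ENNReal.ofReal (∫ z, G0 z) ≤
      ENNReal.ofReal ((∫ x, f x * φ x) + ((∫ z, H z) + L * ∫ z, gP n s p φ z)) := by
    rw [ofReal_integral_eq_lintegral_ofReal hG0i (Eventually.of_forall hG0nn)]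
    calc ∫⁻ z, ENNReal.ofReal (G0 z) = ∫⁻ z, liminf (fun k => ENNReal.ofReal (G k z)) atTop := by
          apply lintegral_congr_ae
          filter_upwards [htend] with z hz
          exact hz.liminf_eq.symm
      _ ≤ liminf (fun k => ∫⁻ z, ENNReal.ofReal (G k z)) atTop :=
          lintegral_liminf_le' fun k => (hGi k).aestronglyMeasurable.aemeasurable.ennreal_ofReal
      _ ≤ liminf (fun k => ENNReal.ofReal ((∫ x, f x * φk k x) + ((∫ z, H z) + L * ∫ z, gP n s p φ z))) atTop := by
          apply liminf_le_liminf
          · refine Eventually.of_forall fun k => ?_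
            rw [← ofReal_integral_eq_lintegral_ofReal (hGi k) (Eventually.of_forall (hGnn k))]
            exact ENNReal.ofReal_le_ofReal (hGle k)
          · isBoundedDefault
          · isBoundedDefault
      _ = _ := (ENNReal.tendsto_ofReal hrt).liminf_eq
  have := (ENNReal.ofReal_le_ofReal_iff hrnn).1 fatou
  rw [hG0int] at this
  linarith

end

section
open Filter Topology


lemma v_bounds (n : ℕ) (hn : 2 ≤ n) (s p : ℝ) (hs : 0 < s) (hp : 1 < p) : ∃ C : ℝ, 0 ≤ C ∧
    ∀ h : ℝ, 0 < h → ∀ u : En n → ℝ, Measurable u → ∀ Λ : ℝ, (∀ x, |u x| ≤ Λ) →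
    ∃ m : En n → ℝ, Measurable m ∧ (∀ x, |m x| ≤ Λ) ∧
      (∫⁻ z, ENNReal.ofReal (gP n s p m z) ≤ ∫⁻ z, ENNReal.ofReal (gP n s p u z)) ∧
      (∀ x, ENNReal.ofReal (|u x - m x| ^ p) ≤ ENNReal.ofReal (C * h ^ (s * p)) * Sx n s p u h x) ∧
      (∀ x x', ‖x - x'‖ ≤ h → ENNReal.ofReal (|m x - m x'| ^ p) ≤
        ENNReal.ofReal (C * (‖x - x'‖ / h) ^ p * h ^ (s * p)) * Sx n s p u h x) := by
  obtain ⟨C1, hC10, hC1⟩ := moll n hn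
  obtain ⟨C2, hC20, hC2⟩ := ker_bound n hn s p hs hp
  refine ⟨C2 * C1 ^ p, by positivity, fun h hh u hu Λ hub => ?_⟩
  obtain ⟨η, hc, h0, hi, h1, hsupp, hbd, hlip⟩ := hC1 h hh
  have hsub := avg_sub n η u hi h1 hu Λ hub
  refine ⟨avg n η u, avg_meas n η u hc hu, avg_bound n η u h0 hi h1 Λ hub,
    avg_contract n s p hp η u hc h0 hi h1 hu Λ hub, fun x => ?_, fun x x' hx => ?_⟩
  · have := hC2 h hh u hu x (fun y => η (x - y)) C1 hC10
      (fun y => by rw [abs_of_nonneg (h0 _)]; exact hbd _)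
      (fun y hy => by have := hsupp _ hy; constructor <;> linarith)
    rw [hsub (u x) x]
    exact this
  · have hd : avg n η u x - avg n η u x' = ∫ y, (η (x' - y) - η (x - y)) * (u x - u y) := by
      have e : avg n η u x - avg n η u x' = (u x - avg n η u x') - (u x - avg n η u x) := by ring
      have hintegr : ∀ x', Integrable (fun y => η (x' - y) * (u x - u y)) := by
        intro x'
        refine Integrable.mul_bdd (c := 2 * Λ) (hi.comp_sub_left x') (by fun_prop) ?_
        refine Eventually.of_forall fun y => ?_
        have := abs_sub (u x) (u y); have := hub x; have := hub y
        rw [Real.norm_eq_abs]; linarith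
      rw [e, hsub, hsub, ← integral_sub (hintegr x') (hintegr x)]
      congr 1; ext y; ring
    have hk := hC2 h hh u hu x (fun y => η (x' - y) - η (x - y)) (C1 * (‖x - x'‖ / h)) (by positivity)
      (fun y => by
        refine (hlip _ _).trans (le_of_eq ?_)
        rw [show x' - y - (x - y) = -(x - x') by abel, norm_neg]; ring)
      (fun y hy => by
        have t1 : ‖x - y‖ ≤ ‖x - x'‖ + ‖x' - y‖ := norm_sub_le_norm_sub_add_norm_sub x x' y
        have t2 : ‖x' - y‖ ≤ ‖x - x'‖ + ‖x - y‖ := by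
          have := norm_sub_le_norm_sub_add_norm_sub x' x y
          rwa [norm_sub_rev x' x] at this
        by_cases h2 : η (x - y) = 0
        · have h3 : η (x' - y) ≠ 0 := by intro h3; apply hy; simp [h2, h3]
          have := hsupp _ h3
          constructor <;> linarith
        · have := hsupp _ h2
          constructor <;> linarith)
    rw [hd]
    refine hk.trans (le_of_eq ?_)
    rw [Real.mul_rpow hC10 (by positivity)]
    congr 2; ring

lemma Sx_meas (n : ℕ) (s p : ℝ) (u : En n → ℝ) (hu : Measurable u) (h : ℝ) :
    Measurable (Sx n s p u h) := by
  unfold Sx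
  have hg := gP_meas n s p u hu
  apply Measurable.lintegral_prod_right (f := fun x y => ENNReal.ofReal
    (if h ≤ ‖x - y‖ then (h / ‖x - y‖) ^ s * gP n s p u (x, y) else 0))
  apply Measurable.ennreal_ofReal
  show Measurable (fun z : En n × En n => if h ≤ ‖z.1 - z.2‖ then (h / ‖z.1 - z.2‖) ^ s * gP n s p u z else 0)
  refine Measurable.ite (measurableSet_le (by fun_prop) (by fun_prop)) (by fun_prop) (by fun_prop)

/-- Near part. -/
def Tn (n : ℕ) (s p : ℝ) (u ψ : En n → ℝ) (h : ℝ) : ℝ≥0∞ :=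
  ∫⁻ z : En n × En n, ENNReal.ofReal (if ‖z.1 - z.2‖ < h then ψ z.1 * gP n s p u z else 0)

/-- Far part. -/
def Sn (n : ℕ) (s p : ℝ) (u ψ : En n → ℝ) (h : ℝ) : ℝ≥0∞ :=
  ∫⁻ z : En n × En n, ENNReal.ofReal
    (if h ≤ ‖z.1 - z.2‖ then ψ z.1 * ((h / ‖z.1 - z.2‖) ^ s * gP n s p u z) else 0)

lemma far_meas (n : ℕ) (s p : ℝ) (u ψ : En n → ℝ) (hu : Measurable u) (hψ : Measurable ψ) (h : ℝ) :
    Measurable (fun z : En n × En n =>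
      if h ≤ ‖z.1 - z.2‖ then ψ z.1 * ((h / ‖z.1 - z.2‖) ^ s * gP n s p u z) else 0) := by
  have hg := gP_meas n s p u hu
  exact Measurable.ite (measurableSet_le (by fun_prop) (by fun_prop)) (by fun_prop) (by fun_prop)

lemma near_meas (n : ℕ) (s p : ℝ) (u ψ : En n → ℝ) (hu : Measurable u) (hψ : Measurable ψ) (h : ℝ) :
    Measurable (fun z : En n × En n =>
      if ‖z.1 - z.2‖ < h then ψ z.1 * gP n s p u z else 0) := by
  have hg := gP_meas n s p u hu
  exact Measurable.ite (measurableSet_lt (by fun_prop) (by fun_prop)) (by fun_prop) (by fun_prop)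

lemma Sx_int (n : ℕ) (s p : ℝ) (u ψ : En n → ℝ) (hu : Measurable u) (hψ : Measurable ψ)
    (hψ0 : ∀ x, 0 ≤ ψ x) (h : ℝ) :
    ∫⁻ x, ENNReal.ofReal (ψ x) * Sx n s p u h x = Sn n s p u ψ h := by
  unfold Sn
  have hg := gP_meas n s p u hu
  rw [Measure.volume_eq_prod, lintegral_prod _ (far_meas n s p u ψ hu hψ h).ennreal_ofReal.aemeasurable]
  apply lintegral_congr
  intro x
  unfold Sx
  rw [← lintegral_const_mul']
  · apply lintegral_congr
    intro y
    rw [← ENNReal.ofReal_mul (hψ0 x)]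
    simp only [mul_ite, mul_zero]
  · exact ENNReal.ofReal_ne_top

lemma Sn_le (n : ℕ) (s p : ℝ) (hs : 0 < s) (u ψ : En n → ℝ) 
    (hψ0 : ∀ x, 0 ≤ ψ x) (hψ1 : ∀ x, ψ x ≤ 1) (h : ℝ) (hh : 0 < h) :
    Sn n s p u ψ h ≤ ∫⁻ z, ENNReal.ofReal (gP n s p u z) := by
  apply lintegral_mono
  intro z
  apply ENNReal.ofReal_le_ofReal
  have hg := gP_nonneg n s p u z
  split_ifs with hd
  · have : (h / ‖z.1 - z.2‖) ^ s ≤ 1 := by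
      apply Real.rpow_le_one (by positivity) _ hs.le
      rw [div_le_one (by linarith)]; exact hd
    have h2 : 0 ≤ (h / ‖z.1 - z.2‖) ^ s := by positivity
    have := mul_le_mul (hψ1 z.1) this h2 zero_le_one
    nlinarith
  · exact hg

lemma Tn_le (n : ℕ) (s p : ℝ) (u ψ : En n → ℝ) 
    (hψ1 : ∀ x, ψ x ≤ 1) (h : ℝ) :
    Tn n s p u ψ h ≤ ∫⁻ z, ENNReal.ofReal (gP n s p u z) := by
  apply lintegral_mono
  intro z
  apply ENNReal.ofReal_le_ofReal
  have hg := gP_nonneg n s p u z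
  split_ifs with hd
  · have := hψ1 z.1
    nlinarith
  · exact hg

end

section
open Filter Topology


/-- Near kernel. -/
def Nk (n : ℕ) (β h : ℝ) (z : En n × En n) : ℝ :=
  if ‖z.1 - z.2‖ < h then ‖z.1 - z.2‖ ^ (β - (n : ℝ)) else 0

lemma Nk_nonneg (n : ℕ) (β h : ℝ) (z : En n × En n) : 0 ≤ Nk n β h z := by
  unfold Nk; split_ifs <;> positivity

lemma Nk_meas (n : ℕ) (β h : ℝ) : Measurable (Nk n β h) := by
  unfold Nk
  refine Measurable.ite (measurableSet_lt (by fun_prop) (by fun_prop)) (by fun_prop) (by fun_prop)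

lemma Nk_swap (n : ℕ) (β h : ℝ) (z : En n × En n) : Nk n β h z.swap = Nk n β h z := by
  unfold Nk; simp [norm_sub_rev]

lemma gP_swap (n : ℕ) (s p : ℝ) (u : En n → ℝ) (z : En n × En n) :
    gP n s p u z.swap = gP n s p u z := by
  unfold gP; simp [norm_sub_rev, abs_sub_comm]

lemma dpow_le (n : ℕ) (s p d : ℝ) (hp : 1 < p) (hd : 0 ≤ d) :
    d ^ p / d ^ ((n : ℝ) + s * p) ≤ d ^ (p - s * p - (n : ℝ)) := by
  rcases hd.eq_or_lt with h | h
  · rw [← h, Real.zero_rpow (by linarith : p ≠ 0), zero_div]; positivity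
  · rw [← Real.rpow_sub h]; apply le_of_eq; congr 1; ring

/-- Near integrand. -/
def Ti (n : ℕ) (s p : ℝ) (u ψ : En n → ℝ) (h : ℝ) (z : En n × En n) : ℝ :=
  if ‖z.1 - z.2‖ < h then ψ z.1 * gP n s p u z else 0

/-- Far integrand. -/
def Si (n : ℕ) (s p : ℝ) (u ψ : En n → ℝ) (h : ℝ) (z : En n × En n) : ℝ :=
  if h ≤ ‖z.1 - z.2‖ then ψ z.1 * ((h / ‖z.1 - z.2‖) ^ s * gP n s p u z) else 0

lemma near_pt (n : ℕ) (p q s t M Λ : ℝ) (a : En n × En n → ℝ) (u : En n → ℝ)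
    (hn : 2 ≤ n) (ht0 : 0 < t) (hp : 1 < p) (hpq : p ≤ q) (hle : t * q ≤ s * p)
    (ha0 : ∀ z, 0 ≤ a z) (haM : ∀ z, a z ≤ M) (hub : ∀ x, |u x| ≤ Λ)
    (m ψ : En n → ℝ) (hψ0 : ∀ x, 0 ≤ ψ x) (K : ℝ) (hK : 0 ≤ K)
    (hlip : ∀ x y, |ψ x - ψ y| ≤ K * ‖x - y‖) (L : ℝ) (hL : L = 1 + M * (2 * Λ) ^ (q - p))
    (h : ℝ) (hh : 0 < h) (hh1 : h ≤ 1) (z : En n × En n) (hz : ‖z.1 - z.2‖ < h) :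
    1 / 2 * (ψ z.1 * gP n s p u z) ≤ formIntegrand n p q s t a u (fun x => ψ x * (u x - m x)) z
      + L * (1 / (2 * L)) ^ (1 - p) * (ψ z.1 * gP n s p m z)
      + L * K * (h * gP n s p u z + h ^ (1 - p) * (Nk n (p - s * p) h z * |u z.2 - m z.2| ^ p)) := by
  have hM : 0 ≤ M := (ha0 z).trans (haM z)
  have hΛ : 0 ≤ Λ := (abs_nonneg _).trans (hub 0)
  have hL0 : 0 < L := by rw [hL]; positivity
  set d := ‖z.1 - z.2‖ with hd
  have hd0 : 0 ≤ d := norm_nonneg _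
  set D := u z.1 - u z.2 with hD
  set V := u z.2 - m z.2 with hV
  set c := cf n p q s t a u z with hc
  set k := 1 / d ^ ((n : ℝ) + s * p) with hk
  have hk0 : 0 ≤ k := by positivity
  have hc1 : k ≤ c := cf_lower n p q s t a u ha0 z
  have hc2 : c ≤ L * k := by
    have := cf_upper n p q s t M Λ a u hn ht0 (by linarith) hpq hle ha0 haM hub z
    rw [← hL] at this
    have hJ : Jk n (t * q) 1 z = 0 := by unfold Jk; rw [if_neg]; rw [← hd]; linarith
    rw [hJ, mul_zero, add_zero] at this
    exact this
  have hgu : gP n s p u z = |D| ^ p * k := by unfold gP; rw [hk]; ring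
  have hgm : gP n s p m z = |m z.1 - m z.2| ^ p * k := by unfold gP; rw [hk]; ring
  set X := |D| ^ (p - 2) * D with hX
  have hXa : |X| = |D| ^ (p - 1) := abs_pow_eq p D hp
  have hXD : X * D = |D| ^ p := pow_mul_eq p D hp
  set P := ψ z.1 with hP
  have hP0 : 0 ≤ P := hψ0 _
  set W := m z.1 - m z.2 with hW
  have hform : formIntegrand n p q s t a u (fun x => ψ x * (u x - m x)) z
      = c * P * |D| ^ p - c * (X * (P * W - (ψ z.1 - ψ z.2) * V)) := by
    rw [form_eq, ← hXD]
    simp only [← hc, ← hD, ← hX, ← hP, hV, hW]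
    ring
  have hl := hlip z.1 z.2
  rw [← hP] at hl
  have hb : |X * (P * W - (P - ψ z.2) * V)| ≤ |D| ^ (p - 1) * (P * |W|) + K * (|D| ^ (p - 1) * (d * |V|)) := by
    rw [abs_mul, hXa]
    have : |P * W - (P - ψ z.2) * V| ≤ P * |W| + K * d * |V| := by
      refine (abs_sub _ _).trans ?_
      rw [abs_mul, abs_mul, abs_of_nonneg hP0]
      gcongr
    calc _ ≤ |D| ^ (p - 1) * (P * |W| + K * d * |V|) := by gcongr
      _ = _ := by ring
  have hy1 := aux_young p (1 / (2 * L)) |D| |W| hp.le (by positivity) (abs_nonneg _) (abs_nonneg _)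
  have hy2 := aux_young p h |D| (d * |V|) hp.le hh (abs_nonneg _) (by positivity)
  rw [Real.mul_rpow hd0 (abs_nonneg _)] at hy2
  have hN : d ^ p * k ≤ Nk n (p - s * p) h z := by
    unfold Nk
    rw [← hd, if_pos hz, hk, mul_one_div]
    exact dpow_le n s p d hp hd0
  have hc0 : 0 ≤ c := hk0.trans hc1
  have e1 : c * (X * (P * W - (P - ψ z.2) * V)) ≤ L * k * (|D| ^ (p - 1) * (P * |W|) + K * (|D| ^ (p - 1) * (d * |V|))) := by
    refine (mul_le_mul_of_nonneg_left ((le_abs_self _).trans hb) hc0).trans ?_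
    exact mul_le_mul_of_nonneg_right hc2 (by positivity)
  have e2 : L * k * (|D| ^ (p - 1) * (P * |W|)) ≤ 1 / 2 * (P * (|D| ^ p * k))
      + L * (1 / (2 * L)) ^ (1 - p) * (P * (|W| ^ p * k)) := by
    have := mul_le_mul_of_nonneg_left hy1 (show 0 ≤ L * k * P by positivity)
    calc _ = L * k * P * (|D| ^ (p - 1) * |W|) := by ring
      _ ≤ _ := this
      _ = (L * (1 / (2 * L))) * (k * P * |D| ^ p) + L * (1 / (2 * L)) ^ (1 - p) * (P * (|W| ^ p * k)) := by ring
      _ = _ := by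
        rw [show L * (1 / (2 * L)) = 1 / 2 by field_simp]; ring
  have e3 : L * k * (K * (|D| ^ (p - 1) * (d * |V|))) ≤ L * K * (h * (|D| ^ p * k)
      + h ^ (1 - p) * (Nk n (p - s * p) h z * |V| ^ p)) := by
    have := mul_le_mul_of_nonneg_left hy2 (show 0 ≤ L * k * K by positivity)
    have h3 : L * K * (h ^ (1 - p) * (d ^ p * k * |V| ^ p)) ≤
      L * K * (h ^ (1 - p) * (Nk n (p - s * p) h z * |V| ^ p)) := by gcongr
    calc _ = L * k * K * (|D| ^ (p - 1) * (d * |V|)) := by ring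
      _ ≤ _ := this
      _ = L * K * (h * (|D| ^ p * k)) + L * K * (h ^ (1 - p) * (d ^ p * k * |V| ^ p)) := by ring
      _ ≤ _ := by linarith
  have e4 : P * (|D| ^ p * k) ≤ c * P * |D| ^ p := by
    have := mul_le_mul_of_nonneg_left hc1 (show 0 ≤ P * |D| ^ p by positivity)
    linarith
  rw [hform, hgu, hgm]
  linarith

lemma far_pt (n : ℕ) (p q s t M Λ : ℝ) (a : En n × En n → ℝ) (u : En n → ℝ)
    (hn : 2 ≤ n) (hs : 0 < s) (ht0 : 0 < t) (hp : 1 < p) (hpq : p ≤ q) (hle : t * q ≤ s * p)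
    (ha0 : ∀ z, 0 ≤ a z) (haM : ∀ z, a z ≤ M) (hub : ∀ x, |u x| ≤ Λ)
    (m ψ : En n → ℝ) (hψ0 : ∀ x, 0 ≤ ψ x) 
    (L : ℝ) (hL : L = 1 + M * (2 * Λ) ^ (q - p))
    (h : ℝ) (hh : 0 < h) (z : En n × En n) (hz : h ≤ ‖z.1 - z.2‖) :
    0 ≤ formIntegrand n p q s t a u (fun x => ψ x * (u x - m x)) z
      + L * (Si n s p u ψ h z + Si n s p u ψ h z.swap)
      + L * h ^ (s * (1 - p)) * (Jk n s h z * (ψ z.1 * |u z.1 - m z.1| ^ p + ψ z.2 * |u z.2 - m z.2| ^ p))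
      + M * (2 * Λ) ^ (q - p) * (2 * Λ) ^ (p - 1) *
        (Jk n (t * q) 1 z * (ψ z.1 * |u z.1 - m z.1| + ψ z.2 * |u z.2 - m z.2|)) := by
  have hM : 0 ≤ M := (ha0 z).trans (haM z)
  have hΛ : 0 ≤ Λ := (abs_nonneg _).trans (hub 0)
  have hL0 : 0 < L := by rw [hL]; positivity
  have hfa := form_abs n p q s t M Λ a u hn ht0 hp hpq hle ha0 haM hub (fun x => ψ x * (u x - m x)) z
  rw [← hL] at hfa
  have hneg := neg_abs_le (formIntegrand n p q s t a u (fun x => ψ x * (u x - m x)) z)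
  simp only [abs_mul, abs_of_nonneg (hψ0 _)] at hfa
  set d := ‖z.1 - z.2‖ with hd
  have hd0 : 0 < d := by linarith
  set U := |u z.1 - u z.2| with hU
  set V1 := |u z.1 - m z.1| with hV1
  set V2 := |u z.2 - m z.2| with hV2
  have hab : |ψ z.1 * (u z.1 - m z.1) - ψ z.2 * (u z.2 - m z.2)| ≤ ψ z.1 * V1 + ψ z.2 * V2 := by
    refine (abs_sub _ _).trans (le_of_eq ?_)
    rw [abs_mul, abs_mul, abs_of_nonneg (hψ0 _), abs_of_nonneg (hψ0 _)]
  set k := 1 / d ^ ((n : ℝ) + s * p) with hk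
  have hk0 : 0 ≤ k := by positivity
  have hgu : gP n s p u z = U ^ p * k := by unfold gP; rw [hk]; ring
  set δ := (h / d) ^ s with hδ
  have hδ0 : 0 < δ := by positivity
  have hJ : Jk n s h z = d ^ (-((n : ℝ) + s)) := by unfold Jk; rw [if_pos hz]
  have hkey : δ ^ (1 - p) * k = h ^ (s * (1 - p)) * Jk n s h z := by
    rw [hJ, hδ, hk, ← Real.rpow_mul (by positivity), Real.div_rpow hh.le hd0.le, one_div,
      ← Real.rpow_neg hd0.le, div_eq_mul_inv, ← Real.rpow_neg hd0.le, mul_assoc, ← Real.rpow_add hd0]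
    congr 2; ring
  have hy : ∀ V, 0 ≤ V → U ^ (p - 1) * V ≤ δ * U ^ p + δ ^ (1 - p) * V ^ p := fun V hV =>
    aux_young p δ U V hp.le hδ0 (abs_nonneg _) hV
  have y : ∀ P V, 0 ≤ P → 0 ≤ V → U ^ (p - 1) * (P * V) * k ≤ P * (δ * (U ^ p * k)) +
      h ^ (s * (1 - p)) * (Jk n s h z * (P * V ^ p)) := by
    intro P V hP hV
    have := mul_le_mul_of_nonneg_left (hy V hV) (mul_nonneg hP hk0)
    calc _ = P * k * (U ^ (p - 1) * V) := by ring
      _ ≤ _ := this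
      _ = P * (δ * (U ^ p * k)) + (δ ^ (1 - p) * k) * (P * V ^ p) := by ring
      _ = _ := by rw [hkey]; ring
  have y1 := y (ψ z.1) V1 (hψ0 _) (abs_nonneg _)
  have y2 := y (ψ z.2) V2 (hψ0 _) (abs_nonneg _)
  have S1 : Si n s p u ψ h z = ψ z.1 * (δ * (U ^ p * k)) := by
    unfold Si; rw [if_pos hz, hgu]
  have S2 : Si n s p u ψ h z.swap = ψ z.2 * (δ * (U ^ p * k)) := by
    unfold Si
    rw [gP_swap, hgu, Prod.fst_swap, Prod.snd_swap, norm_sub_rev, if_pos hz]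
  have g1 : U ^ (p - 1) * |ψ z.1 * (u z.1 - m z.1) - ψ z.2 * (u z.2 - m z.2)| / d ^ ((n : ℝ) + s * p)
      ≤ U ^ (p - 1) * (ψ z.1 * V1) * k + U ^ (p - 1) * (ψ z.2 * V2) * k := by
    rw [div_eq_mul_one_div, ← hk]
    calc _ ≤ U ^ (p - 1) * (ψ z.1 * V1 + ψ z.2 * V2) * k := by gcongr
      _ = _ := by ring
  have g2 := mul_le_mul_of_nonneg_left (g1.trans (add_le_add y1 y2)) hL0.le
  rw [S1, S2]
  linarith

end

section
open Filter Topology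


lemma add_rpow_two (p a b : ℝ) (hp : 1 < p) (ha : 0 ≤ a) (hb : 0 ≤ b) :
    (a + b) ^ p ≤ 2 ^ p * (a ^ p + b ^ p) := by
  have hA : 0 ≤ a ^ p := by positivity
  have hB : 0 ≤ b ^ p := by positivity
  have h2 : (0 : ℝ) ≤ 2 ^ p := by positivity
  rcases le_total a b with h | h
  · calc (a + b) ^ p ≤ (2 * b) ^ p := Real.rpow_le_rpow (by positivity) (by linarith) (by linarith)
      _ = 2 ^ p * b ^ p := Real.mul_rpow (by norm_num) hb
      _ ≤ _ := by gcongr; linarith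
  · calc (a + b) ^ p ≤ (2 * a) ^ p := Real.rpow_le_rpow (by positivity) (by linarith) (by linarith)
      _ = 2 ^ p * a ^ p := Real.mul_rpow (by norm_num) ha
      _ ≤ _ := by gcongr; linarith

lemma gP_prod_fin (n : ℕ) (hn : 2 ≤ n) (s p : ℝ) (hs : 0 < s) (hs1 : s < 1) (hp : 1 < p)
    (v ψ : En n → ℝ) (hv : Measurable v) (hψ0 : ∀ x, 0 ≤ ψ x) (hψ1 : ∀ x, ψ x ≤ 1)
    (K : ℝ) (hK : 0 ≤ K) (hlip : ∀ x y, |ψ x - ψ y| ≤ K * ‖x - y‖)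
    (hvE : ∫⁻ z, ENNReal.ofReal (gP n s p v z) < ⊤)
    (hvp : ∫⁻ x, ENNReal.ofReal (|v x| ^ p) < ⊤) :
    ∫⁻ z, ENNReal.ofReal (gP n s p (fun x => ψ x * v x) z) < ⊤ := by
  have hβ : 0 < p - s * p := by nlinarith
  obtain ⟨C1, hC10, hC1⟩ := rad_in n hn (p - s * p) hβ
  obtain ⟨C2, hC20, hC2⟩ := rad_out n hn (s * p) (by positivity)
  have pt : ∀ z : En n × En n, gP n s p (fun x => ψ x * v x) z ≤
      2 ^ p * (gP n s p v z + (K ^ p * (Nk n (p - s * p) 1 z * |v z.2| ^ p)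
        + Jk n (s * p) 1 z * |v z.2| ^ p)) := by
    intro z
    unfold gP
    dsimp only
    set d := ‖z.1 - z.2‖ with hd
    have hd0 : 0 ≤ d := norm_nonneg _
    have h1 : |ψ z.1 * v z.1 - ψ z.2 * v z.2| ≤ |v z.1 - v z.2| + |ψ z.1 - ψ z.2| * |v z.2| := by
      rw [show ψ z.1 * v z.1 - ψ z.2 * v z.2 = ψ z.1 * (v z.1 - v z.2) + (ψ z.1 - ψ z.2) * v z.2 by ring]
      refine (abs_add_le _ _).trans ?_
      rw [abs_mul, abs_mul, abs_of_nonneg (hψ0 _)]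
      have := mul_le_mul_of_nonneg_right (hψ1 z.1) (abs_nonneg (v z.1 - v z.2))
      linarith
    have h2 : |ψ z.1 * v z.1 - ψ z.2 * v z.2| ^ p ≤
        2 ^ p * (|v z.1 - v z.2| ^ p + |ψ z.1 - ψ z.2| ^ p * |v z.2| ^ p) := by
      refine (Real.rpow_le_rpow (abs_nonneg _) h1 (by linarith)).trans ?_
      refine (add_rpow_two p _ _ hp (abs_nonneg _) (by positivity)).trans ?_
      rw [Real.mul_rpow (abs_nonneg _) (abs_nonneg _)]
    have h3 : |ψ z.1 - ψ z.2| ^ p / d ^ ((n : ℝ) + s * p) ≤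
        K ^ p * Nk n (p - s * p) 1 z + Jk n (s * p) 1 z := by
      have hNn := Nk_nonneg n (p - s * p) 1 z
      have hJn := Jk_nonneg n (s * p) 1 z
      by_cases hz : d < 1
      · have hN : Nk n (p - s * p) 1 z = d ^ (p - s * p - (n : ℝ)) := by unfold Nk; rw [if_pos hz]
        have : |ψ z.1 - ψ z.2| ^ p ≤ K ^ p * d ^ p := by
          rw [← Real.mul_rpow hK hd0]
          exact Real.rpow_le_rpow (abs_nonneg _) (hlip _ _) (by linarith)
        calc _ ≤ K ^ p * d ^ p / d ^ ((n : ℝ) + s * p) := by gcongr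
          _ = K ^ p * (d ^ p / d ^ ((n : ℝ) + s * p)) := by ring
          _ ≤ K ^ p * Nk n (p - s * p) 1 z := by
            rw [hN]; gcongr; exact dpow_le n s p d hp hd0
          _ ≤ _ := by linarith
      · push Not at hz
        have hJ : Jk n (s * p) 1 z = d ^ (-((n : ℝ) + s * p)) := by unfold Jk; rw [if_pos hz]
        have : |ψ z.1 - ψ z.2| ^ p ≤ 1 := by
          apply Real.rpow_le_one (abs_nonneg _) _ (by linarith)
          have := hψ0 z.1; have := hψ0 z.2; have := hψ1 z.1; have := hψ1 z.2
          rw [abs_le]; constructor <;> linarith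
        calc _ ≤ 1 / d ^ ((n : ℝ) + s * p) := by gcongr
          _ = Jk n (s * p) 1 z := by rw [hJ, Real.rpow_neg hd0, one_div]
          _ ≤ _ := by
            have : 0 ≤ K ^ p := by positivity
            nlinarith
    have h4 := mul_le_mul_of_nonneg_right h3 (show 0 ≤ |v z.2| ^ p by positivity)
    calc _ ≤ 2 ^ p * (|v z.1 - v z.2| ^ p + |ψ z.1 - ψ z.2| ^ p * |v z.2| ^ p) / d ^ ((n : ℝ) + s * p) := by
          gcongr
      _ = 2 ^ p * (|v z.1 - v z.2| ^ p / d ^ ((n : ℝ) + s * p) +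
          |ψ z.1 - ψ z.2| ^ p / d ^ ((n : ℝ) + s * p) * |v z.2| ^ p) := by ring
      _ ≤ _ := by
        gcongr
        linarith
  have hNm := Nk_meas n (p - s * p) 1
  have hJm := Jk_meas n (s * p) 1
  have hgm := gP_meas n s p v hv
  have b1 := prod_right (fun z => ENNReal.ofReal (Nk n (p - s * p) 1 z)) (by fun_prop) _
    (fun z => by rw [Nk_swap]) (fun x => hC1 1 one_pos x) (fun x => ENNReal.ofReal (|v x| ^ p)) (by fun_prop)
  have b2 := prod_right (fun z => ENNReal.ofReal (Jk n (s * p) 1 z)) (by fun_prop) _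
    (fun z => by rw [Jk_swap]) (fun x => hC2 1 one_pos x) (fun x => ENNReal.ofReal (|v x| ^ p)) (by fun_prop)
  have c1 := b1.trans_lt (ENNReal.mul_lt_top ENNReal.ofReal_lt_top hvp)
  have c2 := b2.trans_lt (ENNReal.mul_lt_top ENNReal.ofReal_lt_top hvp)
  have i1 : Integrable (fun z : En n × En n => Nk n (p - s * p) 1 z * |v z.2| ^ p) :=
    int_of_lint (by fun_prop) (fun z => mul_nonneg (Nk_nonneg _ _ _ _) (by positivity)) (by
      simpa only [ENNReal.ofReal_mul (Nk_nonneg _ _ _ _)] using c1)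
  have i2 : Integrable (fun z : En n × En n => Jk n (s * p) 1 z * |v z.2| ^ p) :=
    int_of_lint (by fun_prop) (fun z => mul_nonneg (Jk_nonneg _ _ _ _) (by positivity)) (by
      simpa only [ENNReal.ofReal_mul (Jk_nonneg _ _ _ _)] using c2)
  have i3 : Integrable (gP n s p v) := int_of_lint hgm (gP_nonneg n s p v) hvE
  have i4 := (i3.add ((i1.const_mul (K ^ p)).add i2)).const_mul (2 ^ p)
  refine (lintegral_mono fun z => ENNReal.ofReal_le_ofReal (pt z)).trans_lt ?_
  exact lt_of_le_of_lt (lintegral_mono fun z => ENNReal.ofReal_le_ofReal (le_abs_self _)) 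
    (by have := i4.2; rw [hasFiniteIntegral_iff_norm] at this; exact this)

lemma gP_sub_fin (n : ℕ) (s p : ℝ) (hp : 1 < p)
    (u m : En n → ℝ) (hu : Measurable u) (hm : Measurable m) 
    (huE : ∫⁻ z, ENNReal.ofReal (gP n s p u z) < ⊤)
    (hmE : ∫⁻ z, ENNReal.ofReal (gP n s p m z) < ⊤) :
    ∫⁻ z, ENNReal.ofReal (gP n s p (fun x => u x - m x) z) < ⊤ := by
  have i3 : Integrable (gP n s p u) := int_of_lint (gP_meas n s p u hu) (gP_nonneg n s p u) huE
  have i1 : Integrable (gP n s p m) := int_of_lint (gP_meas n s p m hm) (gP_nonneg n s p m) hmE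
  have i4 := (i3.add i1).const_mul (2 ^ p)
  refine lt_of_le_of_lt (lintegral_mono fun z => ENNReal.ofReal_le_ofReal (le_trans ?_ (le_abs_self _)))
    (by have := i4.2; rw [hasFiniteIntegral_iff_norm] at this; exact this)
  simp only [Pi.add_apply]
  unfold gP
  rw [← add_div, ← mul_div_assoc]
  gcongr
  refine le_trans ?_ (add_rpow_two p _ _ hp (abs_nonneg _) (abs_nonneg _))
  apply Real.rpow_le_rpow (abs_nonneg _) _ (by linarith)
  rw [show u z.1 - m z.1 - (u z.2 - m z.2) = (u z.1 - u z.2) - (m z.1 - m z.2) by ring]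
  exact abs_sub _ _

end

section
open Filter Topology


lemma Ti_nonneg (n : ℕ) (s p : ℝ) (u ψ : En n → ℝ) (hψ0 : ∀ x, 0 ≤ ψ x) (h : ℝ) (z : En n × En n) :
    0 ≤ Ti n s p u ψ h z := by
  unfold Ti; split_ifs
  · exact mul_nonneg (hψ0 _) (gP_nonneg _ _ _ _ _)
  · exact le_rfl

lemma Si_nonneg (n : ℕ) (s p : ℝ) (u ψ : En n → ℝ) (hψ0 : ∀ x, 0 ≤ ψ x) (h : ℝ) (hh : 0 < h)
    (z : En n × En n) : 0 ≤ Si n s p u ψ h z := by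
  unfold Si; split_ifs
  · exact mul_nonneg (hψ0 _) (mul_nonneg (by positivity) (gP_nonneg _ _ _ _ _))
  · exact le_rfl

lemma Ti_meas (n : ℕ) (s p : ℝ) (u ψ : En n → ℝ) (hu : Measurable u) (hψ : Measurable ψ) (h : ℝ) :
    Measurable (Ti n s p u ψ h) := near_meas n s p u ψ hu hψ h

lemma Si_meas (n : ℕ) (s p : ℝ) (u ψ : En n → ℝ) (hu : Measurable u) (hψ : Measurable ψ) (h : ℝ) :
    Measurable (Si n s p u ψ h) := far_meas n s p u ψ hu hψ h

lemma ints (n : ℕ) (hn : 2 ≤ n) (s p : ℝ) (hs : 0 < s) (hs1 : s < 1) (hp : 1 < p) :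
    ∃ C1 C2 C3 C4 : ℝ, 0 ≤ C1 ∧ 0 ≤ C2 ∧ 0 ≤ C3 ∧ 0 ≤ C4 ∧
    ∀ h : ℝ, 0 < h → ∀ u : En n → ℝ, Measurable u → ∀ Λ : ℝ, (∀ x, |u x| ≤ Λ) →
    ∃ m : En n → ℝ, Measurable m ∧ (∀ x, |m x| ≤ Λ) ∧
      (∫⁻ z, ENNReal.ofReal (gP n s p m z) ≤ ∫⁻ z, ENNReal.ofReal (gP n s p u z)) ∧
      (∀ ψ : En n → ℝ, Measurable ψ → (∀ x, 0 ≤ ψ x) →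
        ∫⁻ x, ENNReal.ofReal (ψ x * |u x - m x| ^ p) ≤ ENNReal.ofReal (C1 * h ^ (s * p)) * Sn n s p u ψ h) ∧
      (∀ ψ : En n → ℝ, Measurable ψ → (∀ x, 0 ≤ ψ x) →
        ∫⁻ z, ENNReal.ofReal (Ti n s p m ψ h z) ≤ ENNReal.ofReal C2 * Sn n s p u ψ h) ∧
      (∫⁻ z, ENNReal.ofReal (h ^ (1 - p) * (Nk n (p - s * p) h z * |u z.2 - m z.2| ^ p)) ≤
        ENNReal.ofReal (C3 * h) * ∫⁻ z, ENNReal.ofReal (gP n s p u z)) ∧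
      (∀ ψ : En n → ℝ, Measurable ψ → (∀ x, 0 ≤ ψ x) →
        ∫⁻ z, ENNReal.ofReal (h ^ (s * (1 - p)) * (Jk n s h z *
          (ψ z.1 * |u z.1 - m z.1| ^ p + ψ z.2 * |u z.2 - m z.2| ^ p)))
          ≤ ENNReal.ofReal C4 * Sn n s p u ψ h) := by
  have hβ : 0 < p - s * p := by nlinarith
  obtain ⟨A, hA0, hA⟩ := v_bounds n hn s p hs hp
  obtain ⟨Ci, hCi0, hCi⟩ := rad_in n hn (p - s * p) hβ
  obtain ⟨Co, hCo0, hCo⟩ := rad_out n hn s hs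
  refine ⟨A, Ci * A, Ci * A, 2 * Co * A, hA0, by positivity, by positivity, by positivity,
    fun h hh u hu Λ hub => ?_⟩
  obtain ⟨m, hm, hmb, hmE, hv, hmm⟩ := hA h hh u hu Λ hub
  have hSm := Sx_meas n s p u hu h
  have hNm := Nk_meas n (p - s * p) h
  have hJm := Jk_meas n s h
  have hb : ∀ ψ : En n → ℝ, Measurable ψ → (∀ x, 0 ≤ ψ x) →
        ∫⁻ x, ENNReal.ofReal (ψ x * |u x - m x| ^ p) ≤ ENNReal.ofReal (A * h ^ (s * p)) * Sn n s p u ψ h := by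
    intro ψ hψ hψ0
    rw [← Sx_int n s p u ψ hu hψ hψ0 h, ← lintegral_const_mul _ (by fun_prop)]
    apply lintegral_mono
    intro x
    dsimp only
    rw [ENNReal.ofReal_mul (hψ0 x), mul_left_comm]
    gcongr
    exact hv x
  have hb1 : ∫⁻ x, ENNReal.ofReal (|u x - m x| ^ p) ≤ ENNReal.ofReal (A * h ^ (s * p)) *
      ∫⁻ z, ENNReal.ofReal (gP n s p u z) := by
    have := hb (fun _ => 1) (by fun_prop) (fun _ => zero_le_one)
    simp only [one_mul] at this
    refine this.trans ?_
    gcongr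
    exact Sn_le n s p hs u _ (fun _ => zero_le_one) (fun _ => le_rfl) h hh
  refine ⟨m, hm, hmb, hmE, hb, ?_, ?_, ?_⟩
  · intro ψ hψ hψ0
    have pt : ∀ z : En n × En n, ENNReal.ofReal (Ti n s p m ψ h z) ≤
        (ENNReal.ofReal (A * h ^ (s * p - p)) * ENNReal.ofReal (Nk n (p - s * p) h z)) *
          (ENNReal.ofReal (ψ z.1) * Sx n s p u h z.1) := by
      intro z
      unfold Ti
      split_ifs with hz
      · rw [ENNReal.ofReal_mul (hψ0 _), mul_left_comm]
        gcongr
        set d := ‖z.1 - z.2‖ with hd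
        have hd0 : 0 ≤ d := norm_nonneg _
        have h1 := hmm z.1 z.2 hz.le
        have h2 : ENNReal.ofReal (gP n s p m z) =
            ENNReal.ofReal (1 / d ^ ((n : ℝ) + s * p)) * ENNReal.ofReal (|m z.1 - m z.2| ^ p) := by
          rw [← ENNReal.ofReal_mul (by positivity)]; unfold gP; congr 1; ring
        rw [h2]
        refine (mul_le_mul_right h1 _).trans ?_
        rw [← mul_assoc, ← ENNReal.ofReal_mul (by positivity), ← ENNReal.ofReal_mul (by positivity)]
        refine mul_le_mul_left (ENNReal.ofReal_le_ofReal ?_) _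
        have hN : d ^ p / d ^ ((n : ℝ) + s * p) ≤ Nk n (p - s * p) h z := by
          unfold Nk
          rw [← hd, if_pos hz]
          exact dpow_le n s p d hp hd0
        rw [Real.div_rpow hd0 hh.le, Real.rpow_sub hh]
        calc _ = A * (h ^ (s * p) / h ^ p) * (d ^ p / d ^ ((n : ℝ) + s * p)) := by ring
          _ ≤ _ := by gcongr
      · simp
    refine (lintegral_mono pt).trans ?_
    have hk : ∀ x, ∫⁻ y, ENNReal.ofReal (A * h ^ (s * p - p)) * ENNReal.ofReal (Nk n (p - s * p) h (x, y))
        ≤ ENNReal.ofReal (Ci * A) := by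
      intro x
      rw [lintegral_const_mul _ (by fun_prop)]
      refine (mul_le_mul_right (hCi h hh x) _).trans (le_of_eq ?_)
      rw [← ENNReal.ofReal_mul (by positivity)]
      congr 1
      have : h ^ (s * p - p) * h ^ (p - s * p) = 1 := by
        rw [← Real.rpow_add hh]; simp
      calc _ = Ci * A * (h ^ (s * p - p) * h ^ (p - s * p)) := by ring
        _ = _ := by rw [this, mul_one]
    refine (prod_left (fun z => ENNReal.ofReal (A * h ^ (s * p - p)) * ENNReal.ofReal (Nk n (p - s * p) h z))
      (by fun_prop) _ hk (fun x => ENNReal.ofReal (ψ x) * Sx n s p u h x) (by fun_prop)).trans ?_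
    rw [Sx_int n s p u ψ hu hψ hψ0 h]
  · have hk : ∀ x, ∫⁻ y, ENNReal.ofReal (h ^ (1 - p)) * ENNReal.ofReal (Nk n (p - s * p) h (x, y))
        ≤ ENNReal.ofReal (h ^ (1 - p)) * ENNReal.ofReal (Ci * h ^ (p - s * p)) := by
      intro x
      rw [lintegral_const_mul _ (by fun_prop)]
      gcongr
      exact hCi h hh x
    have := prod_right (fun z => ENNReal.ofReal (h ^ (1 - p)) * ENNReal.ofReal (Nk n (p - s * p) h z))
      (by fun_prop) _ (fun z => by rw [Nk_swap]) hk (fun x => ENNReal.ofReal (|u x - m x| ^ p)) (by fun_prop)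
    have e : ∀ z : En n × En n, ENNReal.ofReal (h ^ (1 - p) * (Nk n (p - s * p) h z * |u z.2 - m z.2| ^ p)) =
        ENNReal.ofReal (h ^ (1 - p)) * ENNReal.ofReal (Nk n (p - s * p) h z) * ENNReal.ofReal (|u z.2 - m z.2| ^ p) := by
      intro z
      rw [ENNReal.ofReal_mul (by positivity), ENNReal.ofReal_mul (Nk_nonneg _ _ _ _), mul_assoc]
    simp_rw [e]
    refine this.trans ((mul_le_mul_right hb1 _).trans (le_of_eq ?_))
    rw [← mul_assoc]
    congr 1
    rw [← ENNReal.ofReal_mul (by positivity), ← ENNReal.ofReal_mul (by positivity)]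
    congr 1
    have : h ^ (1 - p) * h ^ (p - s * p) * h ^ (s * p) = h := by
      rw [← Real.rpow_add hh, ← Real.rpow_add hh]; ring_nf; exact Real.rpow_one h
    calc _ = Ci * A * (h ^ (1 - p) * h ^ (p - s * p) * h ^ (s * p)) := by ring
      _ = _ := by rw [this]
  · intro ψ hψ hψ0
    have hk : ∀ x, ∫⁻ y, ENNReal.ofReal (h ^ (s * (1 - p))) * ENNReal.ofReal (Jk n s h (x, y))
        ≤ ENNReal.ofReal (h ^ (s * (1 - p))) * ENNReal.ofReal (Co * h ^ (-s)) := by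
      intro x
      rw [lintegral_const_mul _ (by fun_prop)]
      gcongr
      exact hCo h hh x
    have r1 := prod_right (fun z => ENNReal.ofReal (h ^ (s * (1 - p))) * ENNReal.ofReal (Jk n s h z))
      (by fun_prop) _ (fun z => by rw [Jk_swap]) hk (fun x => ENNReal.ofReal (ψ x * |u x - m x| ^ p)) (by fun_prop)
    have r2 := prod_left (fun z => ENNReal.ofReal (h ^ (s * (1 - p))) * ENNReal.ofReal (Jk n s h z))
      (by fun_prop) _ hk (fun x => ENNReal.ofReal (ψ x * |u x - m x| ^ p)) (by fun_prop)
    have e : ∀ z : En n × En n, ENNReal.ofReal (h ^ (s * (1 - p)) * (Jk n s h z *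
          (ψ z.1 * |u z.1 - m z.1| ^ p + ψ z.2 * |u z.2 - m z.2| ^ p))) =
        ENNReal.ofReal (h ^ (s * (1 - p))) * ENNReal.ofReal (Jk n s h z) * ENNReal.ofReal (ψ z.1 * |u z.1 - m z.1| ^ p)
        + ENNReal.ofReal (h ^ (s * (1 - p))) * ENNReal.ofReal (Jk n s h z) * ENNReal.ofReal (ψ z.2 * |u z.2 - m z.2| ^ p) := by
      intro z
      have := hψ0 z.1; have := hψ0 z.2
      rw [ENNReal.ofReal_mul (by positivity), ENNReal.ofReal_mul (Jk_nonneg _ _ _ _),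
        ENNReal.ofReal_add (by positivity) (by positivity)]
      ring
    simp_rw [e]
    rw [lintegral_add_left (by fun_prop)]
    refine (add_le_add r2 r1).trans ?_
    rw [← two_mul]
    refine (mul_le_mul_right (mul_le_mul_right (hb ψ hψ hψ0) _) _).trans (le_of_eq ?_)
    rw [← mul_assoc, ← mul_assoc]
    congr 1
    rw [show (2 : ℝ≥0∞) = ENNReal.ofReal 2 by simp, ← ENNReal.ofReal_mul (by positivity), ← ENNReal.ofReal_mul (by positivity),
      ← ENNReal.ofReal_mul (by positivity)]
    congr 1
    have : h ^ (s * (1 - p)) * h ^ (-s) * h ^ (s * p) = 1 := by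
      rw [← Real.rpow_add hh, ← Real.rpow_add hh]; ring_nf; exact Real.rpow_zero h
    calc _ = 2 * Co * A * (h ^ (s * (1 - p)) * h ^ (-s) * h ^ (s * p)) := by ring
      _ = _ := by rw [this, mul_one]

end

section
open Filter Topology


lemma lint_to_int {α : Type*} [MeasurableSpace α] {μ : Measure α} {g : α → ℝ} (hg : Measurable g)
    (h0 : ∀ x, 0 ≤ g x) (B : ℝ) (hB : 0 ≤ B) (h : ∫⁻ x, ENNReal.ofReal (g x) ∂μ ≤ ENNReal.ofReal B) :
    Integrable g μ ∧ ∫ x, g x ∂μ ≤ B := by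
  have hi := int_of_lint hg h0 (h.trans_lt ENNReal.ofReal_lt_top)
  refine ⟨hi, ?_⟩
  rw [← ofReal_integral_eq_lintegral_ofReal hi (Eventually.of_forall h0)] at h
  exact (ENNReal.ofReal_le_ofReal_iff hB).1 h

set_option maxHeartbeats 2000000 in
lemma main_ineq (n : ℕ) (p q s t M Λ r : ℝ) (a : En n × En n → ℝ) (u f : En n → ℝ)
    (hn : 2 ≤ n) (hs : 0 < s) (hs1 : s < 1) (ht0 : 0 < t) (hp : 1 < p) (hpq : p ≤ q)
    (hle : t * q ≤ s * p) (hr : 1 < r)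
    (ha : Measurable a)
    (ha0 : ∀ z, 0 ≤ a z) (haM : ∀ z, a z ≤ M) (hub : ∀ x, |u x| ≤ Λ) (hu : Measurable u)
    (huE : ∫⁻ z, ENNReal.ofReal (gP n s p u z) < ⊤)
    (hf : Measurable f) (hfi : ∀ R, IntegrableOn f (closedBall 0 R))
    (hfr : ∀ R, ∫⁻ x in closedBall (0 : En n) R, ENNReal.ofReal (|f x| ^ r) < ⊤)
    (hsol : ∀ φ : En n → ℝ, ContDiff ℝ (⊤ : ℕ∞) φ → HasCompactSupport φ →
      (∫ z : En n × En n, formIntegrand n p q s t a u φ z) = ∫ x, f x * φ x) :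
    ∃ C γ : ℝ, 0 ≤ C ∧ 0 < γ ∧ ∀ (ψ : En n → ℝ) (K R : ℝ), Measurable ψ → (∀ x, 0 ≤ ψ x) →
      (∀ x, ψ x ≤ 1) → 0 ≤ K → (∀ x y, |ψ x - ψ y| ≤ K * ‖x - y‖) → (∀ x, R < ‖x‖ → ψ x = 0) →
      ∃ F : ℝ, 0 ≤ F ∧ ∀ h : ℝ, 0 < h → h ≤ 1 →
        Tn n s p u ψ h ≤ ENNReal.ofReal C * Sn n s p u ψ h + ENNReal.ofReal (F * h ^ γ) := by
  have hM : 0 ≤ M := (ha0 0).trans (haM 0)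
  have hΛ : 0 ≤ Λ := (abs_nonneg _).trans (hub 0)
  obtain ⟨C1, C2, C3, C4, hC1, hC2, hC3, hC4, hall⟩ := ints n hn s p hs hs1 hp
  obtain ⟨CJ, hCJ0, hCJ⟩ := J_lint n hn (t * q) (by nlinarith)
  obtain ⟨L, hL⟩ : ∃ L : ℝ, L = 1 + M * (2 * Λ) ^ (q - p) := ⟨_, rfl⟩
  have hL0 : 0 < L := by rw [hL]; positivity
  obtain ⟨M2, hM2⟩ : ∃ M2 : ℝ, M2 = M * (2 * Λ) ^ (q - p) * (2 * Λ) ^ (p - 1) := ⟨_, rfl⟩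
  have hM20 : 0 ≤ M2 := by rw [hM2]; positivity
  obtain ⟨D1, hD1⟩ : ∃ D1 : ℝ, D1 = L * (1 / (2 * L)) ^ (1 - p) := ⟨_, rfl⟩
  have hD10 : 0 ≤ D1 := by rw [hD1]; positivity
  obtain ⟨γ, hγ⟩ : ∃ γ : ℝ, γ = min (s / 2) (s * (r - 1) / 2) := ⟨_, rfl⟩
  have hγ1 : γ ≤ s / 2 := hγ ▸ min_le_left _ _
  have hγ2 : γ ≤ s * (r - 1) / 2 := hγ ▸ min_le_right _ _
  have hγ0 : 0 < γ := by
    rw [hγ]; apply lt_min (by linarith)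
    have := mul_pos hs (sub_pos.2 hr); linarith
  obtain ⟨E, hE⟩ : ∃ E : ℝ, E = (∫⁻ z, ENNReal.ofReal (gP n s p u z)).toReal := ⟨_, rfl⟩
  have hE0 : 0 ≤ E := by rw [hE]; exact ENNReal.toReal_nonneg
  have hEe : ∫⁻ z, ENNReal.ofReal (gP n s p u z) = ENNReal.ofReal E := by
    rw [hE, ENNReal.ofReal_toReal huE.ne]
  refine ⟨2 * (D1 * C2 + 2 * L + L * C4), γ, by positivity, hγ0, ?_⟩
  intro ψ K R hψ hψ0 hψ1 hK hlip hR
  -- integrals of ψ and ψ|f|^r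
  have hψf : ∫⁻ x, ENNReal.ofReal (ψ x) < ⊤ := by
    have h1 : ∀ x, ENNReal.ofReal (ψ x) ≤ (closedBall (0 : En n) R).indicator (fun _ => 1) x := by
      intro x
      by_cases hx : x ∈ closedBall (0 : En n) R
      · rw [indicator_of_mem hx]; exact ENNReal.ofReal_le_one.2 (hψ1 x)
      · rw [hR x (by simpa using hx)]; simp
    refine (lintegral_mono h1).trans_lt ?_
    rw [lintegral_indicator measurableSet_closedBall]
    simpa using measure_closedBall_lt_top
  have hψfr : ∫⁻ x, ENNReal.ofReal (ψ x * |f x| ^ r) < ⊤ := by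
    have h1 : ∀ x, ENNReal.ofReal (ψ x * |f x| ^ r) ≤
        (closedBall (0 : En n) R).indicator (fun x => ENNReal.ofReal (|f x| ^ r)) x := by
      intro x
      by_cases hx : x ∈ closedBall (0 : En n) R
      · rw [indicator_of_mem hx]
        apply ENNReal.ofReal_le_ofReal
        have := mul_le_mul_of_nonneg_right (hψ1 x) (show 0 ≤ |f x| ^ r by positivity)
        linarith
      · rw [hR x (by simpa using hx)]; simp
    refine (lintegral_mono h1).trans_lt ?_
    rw [lintegral_indicator measurableSet_closedBall]
    exact hfr R
  obtain ⟨I, hI⟩ : ∃ I : ℝ, I = (∫⁻ x, ENNReal.ofReal (ψ x)).toReal := ⟨_, rfl⟩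
  have hI0 : 0 ≤ I := by rw [hI]; exact ENNReal.toReal_nonneg
  have hIe : ∫⁻ x, ENNReal.ofReal (ψ x) = ENNReal.ofReal I := by rw [hI, ENNReal.ofReal_toReal hψf.ne]
  obtain ⟨Q, hQ⟩ : ∃ Q : ℝ, Q = (∫⁻ x, ENNReal.ofReal (ψ x * |f x| ^ r)).toReal := ⟨_, rfl⟩
  have hQ0 : 0 ≤ Q := by rw [hQ]; exact ENNReal.toReal_nonneg
  have hQe : ∫⁻ x, ENNReal.ofReal (ψ x * |f x| ^ r) = ENNReal.ofReal Q := by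
    rw [hQ, ENNReal.ofReal_toReal hψfr.ne]
  obtain ⟨W, hW⟩ : ∃ W : ℝ, W = I + C1 * E := ⟨_, rfl⟩
  have hW0 : 0 ≤ W := by rw [hW]; positivity
  refine ⟨2 * (L * K * (E + C3 * E) + M2 * (CJ * W) + W + 2 * Λ * Q), by positivity, ?_⟩
  intro h hh hh1
  obtain ⟨m, hm, hmb, hmE, i1, i2, i3, i4⟩ := hall h hh u hu Λ hub
  have hvp : ∫⁻ x, ENNReal.ofReal (|u x - m x| ^ p) < ⊤ := by
    have h1 := i1 (fun _ => 1) (by fun_prop) (fun _ => zero_le_one)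
    simp only [one_mul] at h1
    refine h1.trans_lt (ENNReal.mul_lt_top ENNReal.ofReal_lt_top ?_)
    exact (Sn_le n s p hs u _ (fun _ => zero_le_one) (fun _ => le_rfl) h hh).trans_lt huE
  have i1 := i1 ψ hψ hψ0
  have i2 := i2 ψ hψ hψ0
  have i4 := i4 ψ hψ hψ0
  rw [hEe] at i3
  have hSE : Sn n s p u ψ h ≤ ENNReal.ofReal E := by
    rw [← hEe]; exact Sn_le n s p hs u ψ hψ0 hψ1 h hh
  obtain ⟨S, hS⟩ : ∃ S : ℝ, S = (Sn n s p u ψ h).toReal := ⟨_, rfl⟩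
  have hS0 : 0 ≤ S := by rw [hS]; exact ENNReal.toReal_nonneg
  have hSe : Sn n s p u ψ h = ENNReal.ofReal S := by
    rw [hS, ENNReal.ofReal_toReal (hSE.trans_lt ENNReal.ofReal_lt_top).ne]
  have hSE' : S ≤ E := by rw [hSe] at hSE; exact (ENNReal.ofReal_le_ofReal_iff hE0).1 hSE
  rw [hSe, ← ENNReal.ofReal_mul (by positivity)] at i1 i2 i4
  rw [← ENNReal.ofReal_mul (by positivity)] at i3
  have hv2 : ∀ x, |u x - m x| ≤ 2 * Λ := fun x => by
    have := abs_sub (u x) (m x); have := hub x; have := hmb x; linarith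
  -- w
  have hw0 : ∀ x, 0 ≤ ψ x * |u x - m x| := fun x => mul_nonneg (hψ0 x) (abs_nonneg _)
  have hwl : ∫⁻ x, ENNReal.ofReal (ψ x * |u x - m x|) ≤ ENNReal.ofReal (W * h ^ s) := by
    have pt : ∀ x, ENNReal.ofReal (ψ x * |u x - m x|) ≤ ENNReal.ofReal (h ^ s) * ENNReal.ofReal (ψ x)
        + ENNReal.ofReal ((h ^ s) ^ (1 - p)) * ENNReal.ofReal (ψ x * |u x - m x| ^ p) := by
      intro x
      have := hψ0 x
      rw [← ENNReal.ofReal_mul (by positivity), ← ENNReal.ofReal_mul (by positivity),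
        ← ENNReal.ofReal_add (by positivity) (by positivity)]
      apply ENNReal.ofReal_le_ofReal
      have h1 := aux_split p (h ^ s) |u x - m x| hp.le (by positivity) (abs_nonneg _)
      have h2 := mul_le_mul_of_nonneg_left h1 (hψ0 x)
      linarith
    refine (lintegral_mono pt).trans ?_
    rw [lintegral_add_left (by fun_prop), lintegral_const_mul _ (by fun_prop),
      lintegral_const_mul _ (by fun_prop), hIe]
    refine (add_le_add_right (mul_le_mul_right i1 _) _).trans ?_
    rw [← ENNReal.ofReal_mul (by positivity), ← ENNReal.ofReal_mul (by positivity),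
        ← ENNReal.ofReal_add (by positivity) (by positivity)]
    apply ENNReal.ofReal_le_ofReal
    have e : (h ^ s) ^ (1 - p) * h ^ (s * p) = h ^ s := by
      rw [← Real.rpow_mul hh.le, ← Real.rpow_add hh]; congr 1; ring
    calc _ = h ^ s * I + C1 * ((h ^ s) ^ (1 - p) * h ^ (s * p)) * S := by ring
      _ = h ^ s * I + C1 * h ^ s * S := by rw [e]
      _ ≤ h ^ s * I + C1 * h ^ s * E := by gcongr
      _ = _ := by rw [hW]; ring
  have hwm : Measurable (fun x => ψ x * |u x - m x|) := by fun_prop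
  obtain ⟨wi, wI⟩ := lint_to_int hwm hw0 (W * h ^ s) (by positivity) hwl
  -- weak formulation
  have hmE' : ∫⁻ z, ENNReal.ofReal (gP n s p m z) < ⊤ := hmE.trans_lt huE
  have hφE := gP_prod_fin n hn s p hs hs1 hp (fun x => u x - m x) ψ (by fun_prop) hψ0 hψ1 K hK hlip
    (gP_sub_fin n s p hp u m hu hm huE hmE') hvp
  obtain ⟨fi, fI⟩ := weak_ext n p q s t M Λ a u f hn ht0 hp hpq hle ha ha0 haM hub hu huE hf hfi hsol
    (fun x => ψ x * (u x - m x)) (by fun_prop) (2 * Λ) R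
    (fun x => by
      rw [abs_mul, abs_of_nonneg (hψ0 x)]
      have := mul_le_mul (hψ1 x) (hv2 x) (abs_nonneg _) zero_le_one
      linarith)
    (fun x hx => by rw [hR x hx, zero_mul]) hφE
  -- f term
  have fb : ∫ x, f x * (ψ x * (u x - m x)) ≤ W * h ^ (s / 2) + 2 * Λ * Q * h ^ (s * (r - 1) / 2) := by
    obtain ⟨qi, qI⟩ := lint_to_int (g := fun x => ψ x * |f x| ^ r) (μ := volume) (by fun_prop)
      (fun x => mul_nonneg (hψ0 x) (by positivity)) Q hQ0 hQe.le
    obtain ⟨N, hN⟩ : ∃ N : ℝ, N = h ^ (-(s / 2)) := ⟨_, rfl⟩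
    have hN0 : 0 < N := by rw [hN]; positivity
    have pt : ∀ x, |f x * (ψ x * (u x - m x))| ≤ N * (ψ x * |u x - m x|) + 2 * Λ * N ^ (1 - r) * (ψ x * |f x| ^ r) := by
      intro x
      rw [abs_mul, abs_mul, abs_of_nonneg (hψ0 x)]
      have h1 := mul_le_mul_of_nonneg_right (aux_split r N |f x| hr.le hN0 (abs_nonneg _)) (hw0 x)
      have h2 := mul_le_mul_of_nonneg_left (hv2 x) (show 0 ≤ N ^ (1 - r) * |f x| ^ r * ψ x by
        have := hψ0 x; positivity)
      linarith
    have hintegr : Integrable (fun x => N * (ψ x * |u x - m x|) + 2 * Λ * N ^ (1 - r) * (ψ x * |f x| ^ r)) :=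
      (wi.const_mul N).add (qi.const_mul _)
    have h1 : ∫ x, f x * (ψ x * (u x - m x)) ≤ ∫ x, |f x * (ψ x * (u x - m x))| :=
      (le_abs_self _).trans (abs_integral_le_integral_abs)
    have h2 := integral_mono_of_nonneg (μ := volume) (Eventually.of_forall fun x => abs_nonneg (f x * (ψ x * (u x - m x))))
      hintegr (Eventually.of_forall pt)
    rw [integral_add (wi.const_mul N) (qi.const_mul _), integral_const_mul, integral_const_mul] at h2
    refine h1.trans (h2.trans ?_)
    have e1 : N * h ^ s = h ^ (s / 2) := by rw [hN, ← Real.rpow_add hh]; congr 1; ring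
    have e2 : N ^ (1 - r) = h ^ (s * (r - 1) / 2) := by
      rw [hN, ← Real.rpow_mul hh.le]; congr 1; ring
    have h3 := mul_le_mul_of_nonneg_left wI hN0.le
    have h4 := mul_le_mul_of_nonneg_left qI (show 0 ≤ 2 * Λ * N ^ (1 - r) by positivity)
    rw [e2] at h4 ⊢
    calc _ ≤ N * (W * h ^ s) + 2 * Λ * h ^ (s * (r - 1) / 2) * Q := add_le_add h3 h4
      _ = W * (N * h ^ s) + 2 * Λ * Q * h ^ (s * (r - 1) / 2) := by ring
      _ = _ := by rw [e1]
  -- pieces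
  have hNm := Nk_meas n (p - s * p) h
  have hJm := Jk_meas n s h
  have hJm' := Jk_meas n (t * q) 1
  have hSm := Si_meas n s p u ψ hu hψ h
  obtain ⟨r1, R1⟩ := lint_to_int (Ti_meas n s p m ψ hm hψ h) (Ti_nonneg n s p m ψ hψ0 h) _ (by positivity) i2
  obtain ⟨r2, R2⟩ := lint_to_int (gP_meas n s p u hu) (gP_nonneg n s p u) E hE0 hEe.le
  obtain ⟨r3, R3⟩ := lint_to_int (g := fun z : En n × En n => h ^ (1 - p) * (Nk n (p - s * p) h z * |u z.2 - m z.2| ^ p))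
    (by fun_prop) (fun z => mul_nonneg (by positivity) (mul_nonneg (Nk_nonneg _ _ _ _) (by positivity))) _ (by positivity) i3
  obtain ⟨r4, R4⟩ := lint_to_int hSm (Si_nonneg n s p u ψ hψ0 h hh) S hS0 hSe.le
  have hSe' : ∫⁻ z : En n × En n, ENNReal.ofReal (Si n s p u ψ h z.swap) ≤ ENNReal.ofReal S := by
    rw [swap_lint (fun z => ENNReal.ofReal (Si n s p u ψ h z))]; exact hSe.le
  obtain ⟨r5, R5⟩ := lint_to_int (hSm.comp measurable_swap) (fun z => Si_nonneg n s p u ψ hψ0 h hh z.swap) S hS0 hSe'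
  obtain ⟨r6, R6⟩ := lint_to_int (g := fun z : En n × En n => h ^ (s * (1 - p)) * (Jk n s h z *
          (ψ z.1 * |u z.1 - m z.1| ^ p + ψ z.2 * |u z.2 - m z.2| ^ p))) (by fun_prop)
    (fun z => by
      have := hψ0 z.1; have := hψ0 z.2; have := Jk_nonneg n s h z; positivity) _ (by positivity) i4
  have j7 := (hCJ _ hwm hw0).trans (mul_le_mul_right hwl _)
  rw [← ENNReal.ofReal_mul (by positivity)] at j7
  obtain ⟨r7, R7⟩ := lint_to_int (g := fun z : En n × En n => Jk n (t * q) 1 z * (ψ z.1 * |u z.1 - m z.1| + ψ z.2 * |u z.2 - m z.2|))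
    (by fun_prop) (fun z => mul_nonneg (Jk_nonneg _ _ _ _) (add_nonneg (hw0 _) (hw0 _))) _ (by positivity) j7
  have hTm := Ti_meas n s p u ψ hu hψ h
  have hTn := Ti_nonneg n s p u ψ hψ0 h
  have hTfin : ∫⁻ z, ENNReal.ofReal (Ti n s p u ψ h z) < ⊤ := (Tn_le n s p u ψ hψ1 h).trans_lt huE
  have tI := int_of_lint hTm hTn hTfin
  -- abbreviations
  set g1 := Ti n s p m ψ h with hg1
  set g2 := gP n s p u with hg2
  set g3 := fun z : En n × En n => h ^ (1 - p) * (Nk n (p - s * p) h z * |u z.2 - m z.2| ^ p) with hg3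
  set g4 := Si n s p u ψ h with hg4
  set g5 := g4 ∘ Prod.swap with hg5
  set g6 := fun z : En n × En n => h ^ (s * (1 - p)) * (Jk n s h z *
          (ψ z.1 * |u z.1 - m z.1| ^ p + ψ z.2 * |u z.2 - m z.2| ^ p)) with hg6
  set g7 := fun z : En n × En n => Jk n (t * q) 1 z * (ψ z.1 * |u z.1 - m z.1| + ψ z.2 * |u z.2 - m z.2|) with hg7
  set fm := formIntegrand n p q s t a u (fun x => ψ x * (u x - m x)) with hfm
  have n1 : ∀ z, 0 ≤ g1 z := Ti_nonneg n s p m ψ hψ0 h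
  have n2 : ∀ z, 0 ≤ g2 z := gP_nonneg n s p u
  have n3 : ∀ z, 0 ≤ g3 z := fun z => mul_nonneg (by positivity) (mul_nonneg (Nk_nonneg _ _ _ _) (by positivity))
  have n4 : ∀ z, 0 ≤ g4 z := Si_nonneg n s p u ψ hψ0 h hh
  have n5 : ∀ z, 0 ≤ g5 z := fun z => n4 z.swap
  have n6 : ∀ z, 0 ≤ g6 z := fun z => by
      have := hψ0 z.1; have := hψ0 z.2; have := Jk_nonneg n s h z; positivity
  have n7 : ∀ z, 0 ≤ g7 z := fun z => mul_nonneg (Jk_nonneg _ _ _ _) (add_nonneg (hw0 _) (hw0 _))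
  have pt : ∀ z, 1 / 2 * Ti n s p u ψ h z ≤ fm z + (D1 * g1 z + (L * K * h * g2 z + (L * K * g3 z +
      (L * g4 z + (L * g5 z + (L * g6 z + M2 * g7 z)))))) := by
    intro z
    have p1 := mul_nonneg hD10 (n1 z)
    have p2 := mul_nonneg (show 0 ≤ L * K * h by positivity) (n2 z)
    have p3 := mul_nonneg (show 0 ≤ L * K by positivity) (n3 z)
    have p4 := mul_nonneg hL0.le (n4 z)
    have p5 := mul_nonneg hL0.le (n5 z)
    have p6 := mul_nonneg hL0.le (n6 z)
    have p7 := mul_nonneg hM20 (n7 z)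
    by_cases hz : ‖z.1 - z.2‖ < h
    · have := near_pt n p q s t M Λ a u hn ht0 hp hpq hle ha0 haM hub m ψ hψ0 K hK hlip L hL h hh hh1 z hz
      rw [← hD1] at this
      have e1 : Ti n s p u ψ h z = ψ z.1 * g2 z := by unfold Ti; rw [if_pos hz]
      have e2 : g1 z = ψ z.1 * gP n s p m z := by rw [hg1]; unfold Ti; rw [if_pos hz]
      rw [e1]
      rw [← e2] at this
      have : 1 / 2 * (ψ z.1 * g2 z) ≤ fm z + D1 * g1 z + L * K * (h * g2 z + g3 z) := this
      linarith
    · push Not at hz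
      have := far_pt n p q s t M Λ a u hn hs ht0 hp hpq hle ha0 haM hub m ψ hψ0 L hL h hh z hz
      rw [← hM2] at this
      have e1 : Ti n s p u ψ h z = 0 := by unfold Ti; rw [if_neg (not_lt.2 hz)]
      rw [e1]
      rw [mul_assoc L] at this
      have : 0 ≤ fm z + L * (g4 z + g5 z) + L * g6 z + M2 * g7 z := this
      linarith
  have key := integral_mono (tI.const_mul (1 / 2))
    (fi.add ((r1.const_mul D1).add ((r2.const_mul (L * K * h)).add ((r3.const_mul (L * K)).add
      ((r4.const_mul L).add ((r5.const_mul L).add ((r6.const_mul L).add (r7.const_mul M2)))))))) pt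
  have k7 := (r6.const_mul L).add (r7.const_mul M2)
  have k6 := (r5.const_mul L).add k7
  have k5 := (r4.const_mul L).add k6
  have k4 := (r3.const_mul (L * K)).add k5
  have k3 := (r2.const_mul (L * K * h)).add k4
  have k2 := (r1.const_mul D1).add k3
  rw [integral_add' fi k2, integral_add' (r1.const_mul D1) k3, integral_add' (r2.const_mul (L * K * h)) k4,
    integral_add' (r3.const_mul (L * K)) k5, integral_add' (r4.const_mul L) k6,
    integral_add' (r5.const_mul L) k7, integral_add' (r6.const_mul L) (r7.const_mul M2)] at key
  simp only [integral_const_mul] at key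
  have R1' := mul_le_mul_of_nonneg_left R1 hD10
  have R2' := mul_le_mul_of_nonneg_left R2 (show 0 ≤ L * K * h by positivity)
  have R3' := mul_le_mul_of_nonneg_left R3 (show 0 ≤ L * K by positivity)
  have R4' := mul_le_mul_of_nonneg_left R4 hL0.le
  have R5' : L * ∫ z, g5 z ≤ L * S := mul_le_mul_of_nonneg_left R5 hL0.le
  have R6' := mul_le_mul_of_nonneg_left R6 hL0.le
  have R7' := mul_le_mul_of_nonneg_left R7 hM20
  have q1 : h ≤ h ^ γ := by
    have := Real.rpow_le_rpow_of_exponent_ge hh hh1 (show γ ≤ 1 by linarith)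
    rwa [Real.rpow_one] at this
  have q2 : h ^ s ≤ h ^ γ := Real.rpow_le_rpow_of_exponent_ge hh hh1 (by linarith)
  have q3 : h ^ (s / 2) ≤ h ^ γ := Real.rpow_le_rpow_of_exponent_ge hh hh1 hγ1
  have q4 : h ^ (s * (r - 1) / 2) ≤ h ^ γ := Real.rpow_le_rpow_of_exponent_ge hh hh1 hγ2
  have q1' := mul_le_mul_of_nonneg_left q1 (show 0 ≤ L * K * (E + C3 * E) by positivity)
  have q2' := mul_le_mul_of_nonneg_left q2 (show 0 ≤ M2 * (CJ * W) by positivity)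
  have q3' := mul_le_mul_of_nonneg_left q3 hW0
  have q4' := mul_le_mul_of_nonneg_left q4 (show 0 ≤ 2 * Λ * Q by positivity)
  have hT : Tn n s p u ψ h = ENNReal.ofReal (∫ z, Ti n s p u ψ h z) :=
    (ofReal_integral_eq_lintegral_ofReal tI (Eventually.of_forall hTn)).symm
  rw [hT, hSe, ← ENNReal.ofReal_mul (by positivity), ← ENNReal.ofReal_add (by positivity) (by positivity)]
  apply ENNReal.ofReal_le_ofReal
  linarith

end

section
open Filter Topology


lemma seq_decay (b C g : ℝ) (hb0 : 0 < b) (hb1 : b < 1) (hC : 0 ≤ C) (hg0 : 0 < g) (hg1 : g < 1) :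
    ∃ θ : ℝ, 0 < θ ∧ θ < 1 ∧ ∀ (x y : ℕ → ℝ) (F : ℝ), 0 ≤ F → (∀ k, 0 ≤ x k) → (∀ k, 0 ≤ y k) →
      (∀ k, x (k + 1) + y (k + 1) ≤ x k + b * y k) → (∀ k, x k ≤ C * y k + F * g ^ k) →
      ∃ A : ℝ, 0 ≤ A ∧ ∀ k, x k ≤ A * θ ^ k := by
  obtain ⟨κ, hκ⟩ : ∃ κ : ℝ, κ = (1 - b) / (1 + C) := ⟨_, rfl⟩
  have hκ0 : 0 < κ := by rw [hκ]; apply div_pos <;> linarith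
  have hκC : κ * (1 + C) = 1 - b := by rw [hκ]; field_simp
  have hκ1 : κ < 1 := by nlinarith
  obtain ⟨θ, hθ⟩ : ∃ θ : ℝ, θ = (max (1 - κ) g + 1) / 2 := ⟨_, rfl⟩
  have h1 : max (1 - κ) g < 1 := max_lt (by linarith) hg1
  have h2 := le_max_left (1 - κ) g
  have h3 := le_max_right (1 - κ) g
  have hθ1 : θ < 1 := by rw [hθ]; linarith
  have hθκ : 1 - κ < θ := by rw [hθ]; linarith
  have hθg : g ≤ θ := by rw [hθ]; linarith
  have hθ0 : 0 < θ := by linarith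
  refine ⟨θ, hθ0, hθ1, fun x y F hF hx hy hxy hxC => ?_⟩
  obtain ⟨B, hB⟩ : ∃ B : ℝ, B = F / (θ - (1 - κ)) := ⟨_, rfl⟩
  have hd : 0 < θ - (1 - κ) := by linarith
  have hB0 : 0 ≤ B := by rw [hB]; positivity
  have hBF : B * (θ - (1 - κ)) = F := by rw [hB]; field_simp
  have hA0 : 0 ≤ x 0 + y 0 + B := by have := hx 0; have := hy 0; linarith
  refine ⟨x 0 + y 0 + B, hA0, ?_⟩
  have main : ∀ k, x k + y k ≤ (x 0 + y 0 + B) * θ ^ k := by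
    intro k
    induction k with
    | zero => simp; linarith
    | succ k ih =>
      have e1 := hxy k
      have e2 := hxC k
      have e3 : x k + b * y k ≤ (1 - κ) * (x k + y k) + κ * (F * g ^ k) := by
        have := mul_le_mul_of_nonneg_left e2 hκ0.le
        have : b = 1 - κ * (1 + C) := by linarith
        rw [this]; linarith
      have e4 := mul_le_mul_of_nonneg_left ih (show 0 ≤ 1 - κ by linarith)
      have e5 : F * g ^ k ≤ F * θ ^ k := by gcongr
      have e6 : 0 ≤ F * g ^ k := by positivity
      have e7 : κ * (F * g ^ k) ≤ F * θ ^ k := by nlinarith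
      have e8 : F * θ ^ k ≤ (x 0 + y 0 + B) * (θ - (1 - κ)) * θ ^ k := by
        gcongr
        rw [← hBF]
        gcongr
        have := hx 0; have := hy 0; linarith
      rw [pow_succ]
      linarith
  intro k
  have := main k; have := hy k; linarith

lemma half_step (n : ℕ) (s p : ℝ) (hs : 0 < s) (u ψ : En n → ℝ) (hu : Measurable u) (hψ : Measurable ψ)
    (hψ0 : ∀ x, 0 ≤ ψ x) (h : ℝ) (hh : 0 < h) :
    Tn n s p u ψ (h / 2) + Sn n s p u ψ (h / 2) ≤
      Tn n s p u ψ h + ENNReal.ofReal ((1 / 2) ^ s) * Sn n s p u ψ h := by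
  show (∫⁻ z, ENNReal.ofReal (Ti n s p u ψ (h / 2) z)) + (∫⁻ z, ENNReal.ofReal (Si n s p u ψ (h / 2) z))
    ≤ (∫⁻ z, ENNReal.ofReal (Ti n s p u ψ h z)) + ENNReal.ofReal ((1 / 2) ^ s) *
      (∫⁻ z, ENNReal.ofReal (Si n s p u ψ h z))
  rw [← lintegral_const_mul _ (Si_meas n s p u ψ hu hψ h).ennreal_ofReal,
    ← lintegral_add_left (Ti_meas n s p u ψ hu hψ h).ennreal_ofReal,
    ← lintegral_add_left (Ti_meas n s p u ψ hu hψ (h / 2)).ennreal_ofReal]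
  apply lintegral_mono
  intro z
  dsimp only
  rw [← ENNReal.ofReal_mul (by positivity), ← ENNReal.ofReal_add (Ti_nonneg n s p u ψ hψ0 _ z)
    (Si_nonneg n s p u ψ hψ0 _ (by linarith) z), ← ENNReal.ofReal_add (Ti_nonneg n s p u ψ hψ0 _ z)
    (mul_nonneg (by positivity) (Si_nonneg n s p u ψ hψ0 _ hh z))]
  apply ENNReal.ofReal_le_ofReal
  have hg := gP_nonneg n s p u z
  have hψz := hψ0 z.1
  unfold Ti Si
  set d := ‖z.1 - z.2‖ with hd
  by_cases h1 : d < h / 2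
  · have h2 : d < h := by linarith
    rw [if_pos h1, if_pos h2, if_neg (not_le.2 h1), if_neg (not_le.2 h2)]; simp
  · rw [if_neg h1, if_pos (not_lt.1 h1)]
    have h1' := not_lt.1 h1
    have hd0 : 0 < d := by linarith
    by_cases h2 : d < h
    · rw [if_pos h2, if_neg (not_le.2 h2)]
      have : (h / 2 / d) ^ s ≤ 1 := by
        apply Real.rpow_le_one (by positivity) _ hs.le
        rw [div_le_one hd0]; exact h1'
      have := mul_le_mul_of_nonneg_right this (mul_nonneg hψz hg)
      linarith
    · rw [if_neg h2, if_pos (not_lt.1 h2), show h / 2 / d = (1 / 2) * (h / d) by ring,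
        Real.mul_rpow (by norm_num) (by positivity)]
      apply le_of_eq; ring

lemma decay (n : ℕ) (hn : 2 ≤ n) (s p : ℝ) (hs : 0 < s) (hp : 1 < p) (C γ : ℝ) (hC : 0 ≤ C) (hγ : 0 < γ) :
    ∃ η : ℝ, 0 < η ∧ ∀ (u ψ : En n → ℝ) (F : ℝ), Measurable u → Measurable ψ → (∀ x, 0 ≤ ψ x) →
      (∀ x, ψ x ≤ 1) → ∫⁻ z, ENNReal.ofReal (gP n s p u z) < ⊤ → 0 ≤ F →
      (∀ h : ℝ, 0 < h → h ≤ 1 →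
        Tn n s p u ψ h ≤ ENNReal.ofReal C * Sn n s p u ψ h + ENNReal.ofReal (F * h ^ γ)) →
      ∫⁻ z : En n × En n, ENNReal.ofReal (if ‖z.1 - z.2‖ < 1 then
        ψ z.1 * gP n s p u z * ‖z.1 - z.2‖ ^ (-η) else 0) < ⊤ := by
  obtain ⟨θ, hθ0, hθ1, hseq⟩ := seq_decay ((1 / 2) ^ s) C ((1 / 2) ^ γ) (by positivity)
    (Real.rpow_lt_one (by norm_num) (by norm_num) hs) hC (by positivity)
    (Real.rpow_lt_one (by norm_num) (by norm_num) hγ)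
  obtain ⟨η, hη⟩ : ∃ η : ℝ, η = Real.logb 2 (θ ^ (-(1 / 2) : ℝ)) := ⟨_, rfl⟩
  have h2η : (2 : ℝ) ^ η = θ ^ (-(1 / 2) : ℝ) := by
    rw [hη]; exact Real.rpow_logb (by norm_num) (by norm_num) (by positivity)
  have hη0 : 0 < η := by
    rw [hη]; apply Real.logb_pos (by norm_num)
    exact Real.one_lt_rpow_of_pos_of_lt_one_of_neg hθ0 hθ1 (by norm_num)
  have hρ : (2 : ℝ) ^ η * θ < 1 := by
    rw [h2η]; nth_rewrite 2 [← Real.rpow_one θ]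
    rw [← Real.rpow_add hθ0]
    exact Real.rpow_lt_one hθ0.le hθ1 (by norm_num)
  refine ⟨η, hη0, ?_⟩
  intro u ψ F hu hψ hψ0 hψ1 huE hF hmain
  have hhk : ∀ k : ℕ, (0 : ℝ) < (1 / 2) ^ k := fun k => by positivity
  have hhk1 : ∀ k : ℕ, ((1 : ℝ) / 2) ^ k ≤ 1 := fun k => pow_le_one₀ (by norm_num) (by norm_num)
  have hTf : ∀ k : ℕ, Tn n s p u ψ ((1 / 2) ^ k) ≠ ⊤ := fun k =>
    ((Tn_le n s p u ψ hψ1 _).trans_lt huE).ne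
  have hSf : ∀ k : ℕ, Sn n s p u ψ ((1 / 2) ^ k) ≠ ⊤ := fun k =>
    ((Sn_le n s p hs u ψ hψ0 hψ1 _ (hhk k)).trans_lt huE).ne
  obtain ⟨A, hA0, hA⟩ := hseq (fun k => (Tn n s p u ψ ((1 / 2) ^ k)).toReal)
    (fun k => (Sn n s p u ψ ((1 / 2) ^ k)).toReal) F hF (fun k => ENNReal.toReal_nonneg)
    (fun k => ENNReal.toReal_nonneg)
    (fun k => by
      have := half_step n s p hs u ψ hu hψ hψ0 ((1 / 2) ^ k) (hhk k)
      rw [show ((1 : ℝ) / 2) ^ k / 2 = (1 / 2) ^ (k + 1) by rw [pow_succ]; ring] at this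
      have h2 := ENNReal.toReal_mono (ENNReal.add_ne_top.2 ⟨hTf k, ENNReal.mul_ne_top ENNReal.ofReal_ne_top (hSf k)⟩) this
      rw [ENNReal.toReal_add (hTf _) (hSf _), ENNReal.toReal_add (hTf _) (ENNReal.mul_ne_top ENNReal.ofReal_ne_top (hSf k)),
        ENNReal.toReal_mul, ENNReal.toReal_ofReal (by positivity)] at h2
      exact h2)
    (fun k => by
      have := hmain _ (hhk k) (hhk1 k)
      have h2 := ENNReal.toReal_mono (ENNReal.add_ne_top.2 ⟨ENNReal.mul_ne_top ENNReal.ofReal_ne_top (hSf k), ENNReal.ofReal_ne_top⟩) this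
      rw [ENNReal.toReal_add (ENNReal.mul_ne_top ENNReal.ofReal_ne_top (hSf k)) ENNReal.ofReal_ne_top,
        ENNReal.toReal_mul, ENNReal.toReal_ofReal hC, ENNReal.toReal_ofReal (by have := hhk k; positivity)] at h2
      have e : (((1 : ℝ) / 2) ^ k) ^ γ = ((1 / 2) ^ γ) ^ k := by
        rw [← Real.rpow_natCast, ← Real.rpow_natCast, ← Real.rpow_mul (by norm_num), ← Real.rpow_mul (by norm_num), mul_comm]
      rw [e] at h2
      exact h2)
  have hT : ∀ k : ℕ, ∫⁻ z, ENNReal.ofReal (Ti n s p u ψ ((1 / 2) ^ k) z) ≤ ENNReal.ofReal (A * θ ^ k) := by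
    intro k
    have := ENNReal.ofReal_le_ofReal (hA k)
    rw [ENNReal.ofReal_toReal (hTf k)] at this
    exact this
  have pt : ∀ z : En n × En n, ENNReal.ofReal (if ‖z.1 - z.2‖ < 1 then
        ψ z.1 * gP n s p u z * ‖z.1 - z.2‖ ^ (-η) else 0) ≤
      ∑' k : ℕ, ENNReal.ofReal ((2 : ℝ) ^ (η * (k + 1))) * ENNReal.ofReal (Ti n s p u ψ ((1 / 2) ^ k) z) := by
    intro z
    set d := ‖z.1 - z.2‖ with hd
    split_ifs with h1
    · rcases (norm_nonneg _ : 0 ≤ d).eq_or_lt with h0 | h0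
      · have : gP n s p u z = 0 := by
          unfold gP; rw [show ‖z.1 - z.2‖ = 0 from h0.symm, Real.zero_rpow, div_zero]
          have : (0 : ℝ) ≤ n := Nat.cast_nonneg n
          have : 0 < s * p := by positivity
          linarith
        rw [this]; simp
      · obtain ⟨k, hk1, hk2⟩ : ∃ k : ℕ, ((1 : ℝ) / 2) ^ (k + 1) ≤ d ∧ d < (1 / 2) ^ k := by
          obtain ⟨k, hk1, hk2⟩ := exists_nat_pow_near_of_lt_one h0 h1.le (show (0 : ℝ) < 1 / 2 by norm_num) (by norm_num)
          rcases hk2.lt_or_eq with h | h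
          · exact ⟨k, hk1.le, h⟩
          · cases k with
            | zero => simp at h; linarith
            | succ k =>
              refine ⟨k, h.ge, ?_⟩
              have h' : d = (1 / 2) ^ (k + 1) := h
              rw [h', pow_succ]
              have := hhk k
              linarith
        refine le_trans ?_ (ENNReal.le_tsum (k))
        rw [← ENNReal.ofReal_mul (by positivity)]
        apply ENNReal.ofReal_le_ofReal
        have hTi : Ti n s p u ψ ((1 / 2) ^ k) z = ψ z.1 * gP n s p u z := by
          unfold Ti; rw [if_pos hk2]
        rw [hTi, mul_comm ((2 : ℝ) ^ _)]
        apply mul_le_mul_of_nonneg_left _ (mul_nonneg (hψ0 _) (gP_nonneg _ _ _ _ _))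
        have e : (2 : ℝ) ^ (η * ((k : ℝ) + 1)) = (((1 : ℝ) / 2) ^ (k + 1)) ^ (-η) := by
          rw [Real.rpow_neg (by positivity), one_div, inv_pow, Real.inv_rpow (by positivity), inv_inv,
            ← Real.rpow_natCast, ← Real.rpow_mul (by norm_num)]
          congr 1; push_cast; ring
        rw [e]
        exact Real.rpow_le_rpow_of_nonpos (hhk (k + 1)) hk1 (by linarith)
    · simp
  refine (lintegral_mono pt).trans_lt ?_
  rw [lintegral_tsum (fun k => by have := Ti_meas n s p u ψ hu hψ ((1 / 2) ^ k); fun_prop)]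
  have hb : ∀ k : ℕ, ∫⁻ z, ENNReal.ofReal ((2 : ℝ) ^ (η * (k + 1))) * ENNReal.ofReal (Ti n s p u ψ ((1 / 2) ^ k) z)
      ≤ ENNReal.ofReal (A * 2 ^ η * (2 ^ η * θ) ^ k) := by
    intro k
    have := Ti_meas n s p u ψ hu hψ ((1 / 2) ^ k)
    rw [lintegral_const_mul _ (by fun_prop)]
    refine (mul_le_mul_right (hT k) _).trans (le_of_eq ?_)
    rw [← ENNReal.ofReal_mul (by positivity)]
    congr 1
    rw [show η * ((k : ℝ) + 1) = η * k + η by ring, Real.rpow_add (by norm_num), Real.rpow_mul (by norm_num),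
      Real.rpow_natCast, mul_pow]
    ring
  refine (ENNReal.tsum_le_tsum hb).trans_lt ?_
  have hsum : Summable (fun k : ℕ => A * 2 ^ η * (2 ^ η * θ) ^ k) :=
    (summable_geometric_of_lt_one (by positivity) hρ).mul_left _
  rw [← ENNReal.ofReal_tsum_of_nonneg (fun k => by positivity) hsum]
  exact ENNReal.ofReal_lt_top

end

/-- **Theorem 1.1, second part**: under (A1)–(A3), for `p,q ≥ 2`,
`f ∈ L^{p_*+δ₀}_loc(ℝⁿ)` and any bounded weak solution `u ∈ W^{s,p}(ℝⁿ) ∩ L^∞(ℝⁿ)`, there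
exist `ε₁, ε₂ > 0` with `u ∈ W^{s+ε₁,p+ε₂}_loc(ℝⁿ)` (finite Gagliardo seminorm on every
bounded open set); moreover if `(s+ε₁)(p+ε₂) > n` then `u` is locally Hölder continuous
(`u` agrees a.e. with a function that is Hölder continuous on a neighborhood of each point). -/
theorem stmt_1 (n : ℕ) (hn : 2 ≤ n) (p q s t M δ₀ : ℝ)
    (hp : 2 ≤ p) (hpq : p ≤ q) (hq : 2 ≤ q)
    (hs0 : 0 < s) (hs1 : s < 1) (ht0 : 0 < t) (ht1 : t < 1) (hts : t ≤ s)
    (hlow : 1 / pC p ≤ t * q / (s * p)) (hhigh : t * q / (s * p) ≤ 1)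
    (hspn : s * p < n) (hδ₀ : 0 < δ₀)
    (a : En n × En n → ℝ) (ha : Measurable a)
    (ha0 : ∀ z, 0 ≤ a z) (haM : ∀ z, a z ≤ M) (hsymm : ∀ x y, a (x, y) = a (y, x))
    (f : En n → ℝ) (hf : Measurable f)
    (hfloc : ∀ (x₀ : En n) (R : ℝ), 0 < R →
      (∫⁻ x in ball x₀ R, ENNReal.ofReal (|f x| ^ (pStar n p s + δ₀))) < ⊤)
    (u : En n → ℝ) (hu : MemWsp n s p u) (Λ : ℝ) (hub : ∀ x, |u x| ≤ Λ)
    (hsol : IsBoundedWeakSolution n p q s t a u f) :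
    ∃ ε₁ ε₂ : ℝ, 0 < ε₁ ∧ 0 < ε₂ ∧
      (∀ Ω : Set (En n), IsOpen Ω → Bornology.IsBounded Ω →
        (∫⁻ z in Ω ×ˢ Ω,
          ENNReal.ofReal (|u z.1 - u z.2| ^ (p + ε₂)
            / ‖z.1 - z.2‖ ^ ((n : ℝ) + (s + ε₁) * (p + ε₂)))) < ⊤) ∧
      ((s + ε₁) * (p + ε₂) > n →
        ∃ u' : En n → ℝ, (∀ᵐ x, u x = u' x) ∧
          ∀ x : En n, ∃ (C r : NNReal), 0 < r ∧ ∃ sN ∈ nhds x, HolderOnWith C r u' sN) := by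


  have hp1 : 1 < p := by linarith
  have hΛ : 0 ≤ Λ := (abs_nonneg _).trans (hub 0)
  have hn0 : (0 : ℝ) < n := by exact_mod_cast (by omega : 0 < n)
  have hsp : 0 < s * p := by positivity
  have hle : t * q ≤ s * p := by rwa [div_le_one hsp] at hhigh
  have hpS : 1 < pStar n p s := by
    unfold pStar pC
    have h1 : 0 < p - 1 := by linarith
    rw [lt_div_iff₀ (by positivity), one_mul, ← sub_pos]
    have : (n : ℝ) * (p / (p - 1)) - ((n : ℝ) + s * (p / (p - 1))) = ((n : ℝ) - s * p) / (p - 1) := by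
      field_simp; ring
    rw [this]
    exact div_pos (by linarith) h1
  obtain ⟨r, hr⟩ : ∃ r : ℝ, r = pStar n p s + δ₀ := ⟨_, rfl⟩
  have hr1 : 1 < r := by linarith
  rw [← hr] at hfloc
  have hfr : ∀ R, ∫⁻ x in closedBall (0 : En n) R, ENNReal.ofReal (|f x| ^ r) < ⊤ := by
    intro R
    refine (lintegral_mono_set (closedBall_subset_ball (show R < |R| + 1 by
      have := le_abs_self R; linarith))).trans_lt (hfloc 0 (|R| + 1) (by positivity))
  have hfi : ∀ R, IntegrableOn f (closedBall (0 : En n) R) := by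
    intro R
    have i1 : Integrable (fun x => |f x| ^ r) (volume.restrict (closedBall (0 : En n) R)) :=
      int_of_lint (by fun_prop) (fun x => by positivity) (hfr R)
    have i2 : IntegrableOn (fun _ => (1 : ℝ)) (closedBall (0 : En n) R) :=
      integrableOn_const (measure_closedBall_lt_top).ne
    refine (i2.add i1).mono' hf.aestronglyMeasurable (Filter.Eventually.of_forall fun x => ?_)
    have := aux_split r 1 |f x| hr1.le one_pos (abs_nonneg _)
    simpa using this
  have huE : ∫⁻ z, ENNReal.ofReal (gP n s p u z) < ⊤ := hu.2.2
  obtain ⟨C, γ, hC, hγ, hmain⟩ := main_ineq n p q s t M Λ r a u f hn hs0 hs1 ht0 hp1 hpq hle hr1 ha ha0 haM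
    hub hu.1 huE hf hfi hfr hsol.2
  obtain ⟨η, hη, hdec⟩ := decay n hn s p hs0 hp1 C γ hC hγ
  obtain ⟨ε, hε⟩ : ∃ ε : ℝ, ε = min 1 (min η ((n : ℝ) - s * p) / (p + s + 1)) := ⟨_, rfl⟩
  have hm0 : 0 < min η ((n : ℝ) - s * p) := lt_min hη (by linarith)
  have hε0 : 0 < ε := by rw [hε]; exact lt_min one_pos (by positivity)
  have hε1 : ε ≤ 1 := hε ▸ min_le_left _ _
  have hε2 : ε * (p + s + 1) ≤ min η ((n : ℝ) - s * p) := by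
    rw [← le_div_iff₀ (by positivity)]; exact hε ▸ min_le_right _ _
  obtain ⟨e, he⟩ : ∃ e : ℝ, e = ε * (p + s + ε) := ⟨_, rfl⟩
  have he0 : 0 < e := by rw [he]; positivity
  have hee : e ≤ min η ((n : ℝ) - s * p) := by
    refine le_trans ?_ hε2
    rw [he]; gcongr
  have heη : e ≤ η := hee.trans (min_le_left _ _)
  have hen : e ≤ (n : ℝ) - s * p := hee.trans (min_le_right _ _)
  have hexp : (s + ε) * (p + ε) = s * p + e := by rw [he]; ring
  refine ⟨ε, ε, hε0, hε0, ?_, ?_⟩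
  swap
  · intro hgt
    rw [hexp] at hgt
    linarith
  intro Ω hΩ hΩb
  obtain ⟨ρ, hρ⟩ := hΩb.subset_closedBall (0 : En n)
  let ψ : En n → ℝ := fun x => max 0 (min 1 (ρ + 1 - ‖x‖))
  have hψm : Measurable ψ := by fun_prop
  have hψ0 : ∀ x, 0 ≤ ψ x := fun x => le_max_left _ _
  have hψ1 : ∀ x, ψ x ≤ 1 := fun x => max_le zero_le_one (min_le_left _ _)
  have hlip : ∀ x y, |ψ x - ψ y| ≤ 1 * ‖x - y‖ := by
    intro x y
    rw [one_mul]
    have h1 : |max 0 (min 1 (ρ + 1 - ‖x‖)) - max 0 (min 1 (ρ + 1 - ‖y‖))| ≤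
        |min 1 (ρ + 1 - ‖x‖) - min 1 (ρ + 1 - ‖y‖)| := by
      have := abs_max_sub_max_le_max 0 (min 1 (ρ + 1 - ‖x‖)) 0 (min 1 (ρ + 1 - ‖y‖))
      simpa using this
    have h2 : |min 1 (ρ + 1 - ‖x‖) - min 1 (ρ + 1 - ‖y‖)| ≤ |(ρ + 1 - ‖x‖) - (ρ + 1 - ‖y‖)| := by
      have := abs_min_sub_min_le_max 1 (ρ + 1 - ‖x‖) 1 (ρ + 1 - ‖y‖)
      simpa using this
    have h3 : |(ρ + 1 - ‖x‖) - (ρ + 1 - ‖y‖)| ≤ ‖x - y‖ := by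
      rw [show (ρ + 1 - ‖x‖) - (ρ + 1 - ‖y‖) = ‖y‖ - ‖x‖ by ring, norm_sub_rev x y]
      exact abs_norm_sub_norm_le y x
    exact h1.trans (h2.trans h3)
  have hsupp : ∀ x, ρ + 1 < ‖x‖ → ψ x = 0 := by
    intro x hx
    apply max_eq_left
    exact (min_le_right _ _).trans (by linarith)
  have hψΩ : ∀ x ∈ Ω, ψ x = 1 := by
    intro x hx
    have := hρ hx
    rw [mem_closedBall_zero_iff] at this
    show max 0 (min 1 (ρ + 1 - ‖x‖)) = 1
    rw [min_eq_left (by linarith), max_eq_right zero_le_one]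
  obtain ⟨F, hF, hT⟩ := hmain ψ 1 (ρ + 1) hψm hψ0 hψ1 zero_le_one hlip hsupp
  have hfin := hdec u ψ F hu.1 hψm hψ0 hψ1 huE hF hT
  have pt : ∀ z ∈ Ω ×ˢ Ω, ENNReal.ofReal (|u z.1 - u z.2| ^ (p + ε)
            / ‖z.1 - z.2‖ ^ ((n : ℝ) + (s + ε) * (p + ε))) ≤
      ENNReal.ofReal ((2 * Λ) ^ ε) * ENNReal.ofReal (gP n s p u z) +
      ENNReal.ofReal ((2 * Λ) ^ ε) * ENNReal.ofReal (if ‖z.1 - z.2‖ < 1 then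
        ψ z.1 * gP n s p u z * ‖z.1 - z.2‖ ^ (-η) else 0) := by
    intro z hz
    have hg := gP_nonneg n s p u z
    rw [hψΩ z.1 hz.1, one_mul, hexp]
    have h0 : 0 ≤ (if ‖z.1 - z.2‖ < 1 then gP n s p u z * ‖z.1 - z.2‖ ^ (-η) else 0) := by
      split_ifs <;> positivity
    rw [← ENNReal.ofReal_mul (by positivity), ← ENNReal.ofReal_mul (by positivity),
      ← ENNReal.ofReal_add (by positivity) (by positivity)]
    apply ENNReal.ofReal_le_ofReal
    rcases (norm_nonneg (z.1 - z.2)).eq_or_lt with hd | hd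
    · rw [← hd, Real.zero_rpow (by positivity), div_zero]
      rw [← hd] at h0
      positivity
    · have hU : |u z.1 - u z.2| ≤ 2 * Λ := by
        have := abs_sub (u z.1) (u z.2); have := hub z.1; have := hub z.2; linarith
      have h1 : |u z.1 - u z.2| ^ (p + ε) ≤ |u z.1 - u z.2| ^ p * (2 * Λ) ^ ε := by
        rw [Real.rpow_add_of_nonneg (abs_nonneg _) (by linarith) hε0.le]
        gcongr
      have h2 : |u z.1 - u z.2| ^ (p + ε) / ‖z.1 - z.2‖ ^ ((n : ℝ) + (s * p + e)) ≤
          (2 * Λ) ^ ε * (gP n s p u z * ‖z.1 - z.2‖ ^ (-e)) := by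
        rw [← add_assoc, Real.rpow_add hd, Real.rpow_neg hd.le]
        unfold gP
        calc _ ≤ |u z.1 - u z.2| ^ p * (2 * Λ) ^ ε / (‖z.1 - z.2‖ ^ ((n : ℝ) + s * p) * ‖z.1 - z.2‖ ^ e) := by
              gcongr
          _ = _ := by
              field_simp
      refine h2.trans ?_
      rw [← mul_add]
      apply mul_le_mul_of_nonneg_left _ (by positivity)
      split_ifs with h3
      · have : ‖z.1 - z.2‖ ^ (-e) ≤ ‖z.1 - z.2‖ ^ (-η) :=
          Real.rpow_le_rpow_of_exponent_ge hd h3.le (by linarith)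
        have := mul_le_mul_of_nonneg_left this hg
        linarith
      · have : ‖z.1 - z.2‖ ^ (-e) ≤ 1 :=
          Real.rpow_le_one_of_one_le_of_nonpos (not_lt.1 h3) (by linarith)
        have := mul_le_mul_of_nonneg_left this hg
        linarith
  refine (setLIntegral_mono' (hΩ.measurableSet.prod hΩ.measurableSet) pt).trans_lt ?_
  refine (setLIntegral_le_lintegral _ _).trans_lt ?_
  have hgm := gP_meas n s p u hu.1
  rw [lintegral_add_left (by fun_prop), lintegral_const_mul' _ _ ENNReal.ofReal_ne_top,
    lintegral_const_mul' _ _ ENNReal.ofReal_ne_top]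
  exact ENNReal.add_lt_top.2 ⟨ENNReal.mul_lt_top ENNReal.ofReal_lt_top huE,
    ENNReal.mul_lt_top ENNReal.ofReal_lt_top hfin⟩

end
end

section
/- Let n ≥ 2 and p ∈ (1,∞). There exists a constant C_d = C_d(n,p) such that for every ε ∈ (0,1/p), every a ∈ (0,1], every R > 0 and every x ∈ ℝⁿ, and for any two axis-parallel cubes K₁, K₂ ⊂ B(x,R) with |K₁| = |K₂| = (aR)ⁿ, one has ν(𝓑(x,R)) / ν(K₁ × K₂) ≤ C_d / (a^{2n} ε), where 𝓑(x,R) = B(x,R)×B(x,R). -/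
open MeasureTheory Metric Set
open scoped ENNReal

noncomputable section

/-- The dual-pair measure `ν` on `ℝⁿ × ℝⁿ`, with density `|x−y|^{−(n−εp)}`
with respect to Lebesgue measure. -/
def nu (n : ℕ) (p ε : ℝ) :
    Measure (EuclideanSpace ℝ (Fin n) × EuclideanSpace ℝ (Fin n)) :=
  volume.withDensity fun z => ENNReal.ofReal (‖z.1 - z.2‖ ^ (ε * p - n))

/-- The half-open axis-parallel cube in `ℝⁿ` with "lower-left" corner `c` and side length `ℓ`
(so its Lebesgue measure is `ℓⁿ`). -/
def cube (n : ℕ) (c : EuclideanSpace ℝ (Fin n)) (ℓ : ℝ) : Set (EuclideanSpace ℝ (Fin n)) :=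
  {y | ∀ i, c i ≤ y i ∧ y i < c i + ℓ}

theorem aux_radial (n : ℕ) (hn : 2 ≤ n) (s r : ℝ) (hs : 0 < s) (hr : 0 < r) :
    ∫⁻ y in ball (0 : EuclideanSpace ℝ (Fin n)) r, ENNReal.ofReal (‖y‖ ^ (s - n)) =
      ENNReal.ofReal (n * (volume.real (ball (0 : EuclideanSpace ℝ (Fin n)) 1) * (r ^ s / s))) := by
  have : Nonempty (Fin n) := ⟨⟨0, by omega⟩⟩
  have hdim : Module.finrank ℝ (EuclideanSpace ℝ (Fin n)) = n := by simp
  have key : ∀ y ∈ Ioo (0 : ℝ) r, y ^ (s - 1) = y ^ (n - 1) • y ^ (s - n) := by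
    intro y hy
    rw [smul_eq_mul, ← Real.rpow_natCast, ← Real.rpow_add hy.1]
    congr 1
    rw [Nat.cast_sub (by omega)]
    push_cast
    ring
  have hint0 : IntegrableOn (fun y : ℝ => y ^ (s - 1)) (Ioo 0 r) := by
    have := intervalIntegral.intervalIntegrable_rpow' (a := 0) (b := r) (r := s - 1) (by linarith)
    rw [intervalIntegrable_iff_integrableOn_Ioo_of_le hr.le] at this
    exact this
  have hint : IntegrableOn (fun y : EuclideanSpace ℝ (Fin n) => ‖y‖ ^ (s - n)) (ball 0 r) := by
    rw [integrableOn_fun_norm_addHaar volume (f := fun t : ℝ => t ^ (s - n)), hdim]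
    exact hint0.congr_fun key measurableSet_Ioo
  rw [← ofReal_integral_eq_lintegral_ofReal hint
    (Filter.Eventually.of_forall fun y => Real.rpow_nonneg (norm_nonneg _) _)]
  congr 1
  have h1 : ∫ y in ball (0 : EuclideanSpace ℝ (Fin n)) r, ‖y‖ ^ (s - n) =
      ∫ y : EuclideanSpace ℝ (Fin n), (Iio r).indicator (fun t : ℝ => t ^ (s - n)) ‖y‖ := by
    rw [← integral_indicator measurableSet_ball]
    congr 1
    ext y
    simp [indicator]
  rw [h1, integral_fun_norm_addHaar volume, hdim, nsmul_eq_mul, smul_eq_mul]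
  congr 2
  have h2 : ∫ y in Ioi (0 : ℝ), y ^ (n - 1) • (Iio r).indicator (fun t : ℝ => t ^ (s - n)) y =
      ∫ y in Ioi (0 : ℝ), (Iio r).indicator (fun t : ℝ => t ^ (n - 1) • t ^ (s - n)) y := by
    congr 1
    ext y
    by_cases h : y < r <;> simp [h]
  rw [h2, setIntegral_indicator measurableSet_Iio, Ioi_inter_Iio,
    ← setIntegral_congr_fun measurableSet_Ioo key, ← integral_Ioc_eq_integral_Ioo,
    ← intervalIntegral.integral_of_le hr.le, integral_rpow (Or.inl (by linarith))]
  simp [Real.zero_rpow hs.ne']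

theorem cube_eq (n : ℕ) (c : EuclideanSpace ℝ (Fin n)) (l : ℝ) :
    cube n c l = (@WithLp.ofLp 2 (Fin n → ℝ)) ⁻¹' (Set.pi univ fun i => Ico (c i) (c i + l)) := by
  ext y
  simp [cube]

theorem cube_meas (n : ℕ) (c : EuclideanSpace ℝ (Fin n)) (l : ℝ) :
    MeasurableSet (cube n c l) := by
  rw [cube_eq]
  exact (PiLp.volume_preserving_ofLp (Fin n)).measurable
    (MeasurableSet.univ_pi fun _ => measurableSet_Ico)

theorem cube_vol (n : ℕ) (c : EuclideanSpace ℝ (Fin n)) (l : ℝ) (hl : 0 ≤ l) :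
    volume (cube n c l) = ENNReal.ofReal (l ^ n) := by
  rw [cube_eq, (PiLp.volume_preserving_ofLp (Fin n)).measure_preimage
    (MeasurableSet.univ_pi fun _ => measurableSet_Ico).nullMeasurableSet, Real.volume_pi_Ico]
  simp [ENNReal.ofReal_pow hl]

theorem dens_meas (n : ℕ) (t : ℝ) : Measurable
    fun z : EuclideanSpace ℝ (Fin n) × EuclideanSpace ℝ (Fin n) =>
      ENNReal.ofReal (‖z.1 - z.2‖ ^ t) := by
  fun_prop

theorem nu_prod (n : ℕ) (p ε : ℝ) (A B : Set (EuclideanSpace ℝ (Fin n)))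
    (hA : MeasurableSet A) (hB : MeasurableSet B) :
    nu n p ε (A ×ˢ B) =
      ∫⁻ x in A, ∫⁻ y in B, ENNReal.ofReal (‖x - y‖ ^ (ε * p - n)) := by
  rw [nu, withDensity_apply _ (hA.prod hB), Measure.volume_eq_prod,
    setLIntegral_prod _ (dens_meas n _).aemeasurable]

theorem upper (n : ℕ) (hn : 2 ≤ n) (p ε R : ℝ) (hs : 0 < ε * p) (hR : 0 < R)
    (x : EuclideanSpace ℝ (Fin n)) :
    nu n p ε (ball x R ×ˢ ball x R) ≤
      ENNReal.ofReal (n * (volume.real (ball (0 : EuclideanSpace ℝ (Fin n)) 1)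
        * ((2 * R) ^ (ε * p) / (ε * p))) *
        (R ^ n * volume.real (ball (0 : EuclideanSpace ℝ (Fin n)) 1))) := by
  rw [nu_prod _ _ _ _ _ measurableSet_ball measurableSet_ball]
  have hw : volume (ball x R) =
      ENNReal.ofReal (R ^ n * volume.real (ball (0 : EuclideanSpace ℝ (Fin n)) 1)) := by
    rw [Measure.addHaar_ball_of_pos _ _ hR, ENNReal.ofReal_mul (by positivity),
      ofReal_measureReal measure_ball_lt_top.ne]
    simp
  have inner : ∀ u ∈ ball x R, ∫⁻ y in ball x R, ENNReal.ofReal (‖u - y‖ ^ (ε * p - n)) ≤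
      ENNReal.ofReal (n * (volume.real (ball (0 : EuclideanSpace ℝ (Fin n)) 1)
        * ((2 * R) ^ (ε * p) / (ε * p)))) := by
    intro u hu
    rw [← aux_radial n hn _ _ hs (by positivity : 0 < 2 * R),
      ← lintegral_indicator measurableSet_ball, ← lintegral_indicator measurableSet_ball,
      ← lintegral_sub_left_eq_self ((ball (0 : EuclideanSpace ℝ (Fin n)) (2 * R)).indicator
        fun y => ENNReal.ofReal (‖y‖ ^ (ε * p - n))) u]
    apply lintegral_mono
    intro y
    by_cases hy : y ∈ ball x R
    · have : u - y ∈ ball (0 : EuclideanSpace ℝ (Fin n)) (2 * R) := by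
        rw [mem_ball_zero_iff, ← dist_eq_norm]
        have := dist_triangle_right u y x
        rw [mem_ball] at hu hy
        linarith
      simp only [indicator_of_mem hy, indicator_of_mem this]
      exact le_rfl
    · simp only [indicator_of_notMem hy]
      exact bot_le
  refine (setLIntegral_mono' measurableSet_ball inner).trans ?_
  rw [setLIntegral_const, hw, ← ENNReal.ofReal_mul (by positivity)]

theorem lower (n : ℕ) (hn : 2 ≤ n) (p ε R l : ℝ) (hs : ε * p < 1) (hl : 0 ≤ l)
    (x c₁ c₂ : EuclideanSpace ℝ (Fin n))
    (h1 : cube n c₁ l ⊆ ball x R) (h2 : cube n c₂ l ⊆ ball x R) :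
    ENNReal.ofReal ((2 * R) ^ (ε * p - n) * l ^ n * l ^ n) ≤
      nu n p ε (cube n c₁ l ×ˢ cube n c₂ l) := by
  have : Nonempty (Fin n) := ⟨⟨0, by omega⟩⟩
  rw [nu_prod _ _ _ _ _ (cube_meas ..) (cube_meas ..)]
  have hn' : (2 : ℝ) ≤ n := by exact_mod_cast hn
  have inner : ∀ u ∈ cube n c₁ l, ENNReal.ofReal ((2 * R) ^ (ε * p - n) * l ^ n) ≤
      ∫⁻ y in cube n c₂ l, ENNReal.ofReal (‖u - y‖ ^ (ε * p - n)) := by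
    intro u hu
    rw [ENNReal.ofReal_mul' (by positivity), ← cube_vol n c₂ l hl, ← setLIntegral_const]
    apply setLIntegral_mono_ae' (cube_meas ..)
    have hne : ∀ᵐ y : EuclideanSpace ℝ (Fin n), y ≠ u := by
      simp [ae_iff]
    filter_upwards [hne] with y hy hyc
    apply ENNReal.ofReal_le_ofReal
    have hu' := h1 hu
    have hy' := h2 hyc
    rw [mem_ball] at hu' hy'
    have := dist_triangle_right u y x
    rw [dist_eq_norm] at this
    exact Real.rpow_le_rpow_of_nonpos (norm_pos_iff.2 (sub_ne_zero.2 (Ne.symm hy)))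
      (by linarith) (by linarith)
  refine le_trans ?_ (setLIntegral_mono' (cube_meas ..) inner)
  rw [setLIntegral_const, cube_vol n c₁ l hl, ENNReal.ofReal_mul' (by positivity)]

/-- for `n ≥ 2`, `p ∈ (1,∞)` there is a constant `C_d = C_d(n,p)` such that
for every `ε ∈ (0,1/p)`, every `a ∈ (0,1]`, `R > 0`, `x ∈ ℝⁿ` and any two axis-parallel
cubes `K₁, K₂ ⊂ B(x,R)` with `|K₁| = |K₂| = (aR)ⁿ` (i.e. of side length `aR`),
`ν(𝓑(x,R)) / ν(K₁ × K₂) ≤ C_d / (a^{2n} ε)`. -/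
theorem stmt_5 (n : ℕ) (hn : 2 ≤ n) (p : ℝ) (hp : 1 < p) :
    ∃ Cd : ℝ, 0 < Cd ∧
      ∀ ε : ℝ, 0 < ε → ε < 1 / p →
      ∀ a : ℝ, 0 < a → a ≤ 1 →
      ∀ R : ℝ, 0 < R →
      ∀ x c₁ c₂ : EuclideanSpace ℝ (Fin n),
        cube n c₁ (a * R) ⊆ ball x R → cube n c₂ (a * R) ⊆ ball x R →
        nu n p ε (ball x R ×ˢ ball x R) /
            nu n p ε (cube n c₁ (a * R) ×ˢ cube n c₂ (a * R)) ≤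
          ENNReal.ofReal (Cd / (a ^ (2 * n) * ε)) := by
  have : Nonempty (Fin n) := ⟨⟨0, by omega⟩⟩
  set w := volume.real (ball (0 : EuclideanSpace ℝ (Fin n)) 1) with hw
  have hw0 : 0 < w := ENNReal.toReal_pos (measure_ball_pos _ _ one_pos).ne' measure_ball_lt_top.ne
  have hn0 : (0 : ℝ) < n := by exact_mod_cast (by omega : 0 < n)
  refine ⟨n * w ^ 2 * 2 ^ n, by positivity, ?_⟩
  intro ε hε hεp a ha ha1 R hR x c₁ c₂ h1 h2
  have hp0 : 0 < p := by linarith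
  have hs : 0 < ε * p := by positivity
  have hs1 : ε * p < 1 := (lt_div_iff₀ hp0).1 hεp
  apply ENNReal.div_le_of_le_mul
  refine (upper n hn p ε R hs hR x).trans ?_
  refine le_trans ?_ (mul_le_mul_right (lower n hn p ε R (a * R) hs1 (by positivity) x c₁ c₂ h1 h2) _)
  rw [← ENNReal.ofReal_mul (by positivity)]
  apply ENNReal.ofReal_le_ofReal
  rw [← hw, Real.rpow_sub (by positivity), Real.rpow_natCast]
  have e1 : n * w ^ 2 * 2 ^ n / (a ^ (2 * n) * ε) *
      ((2 * R) ^ (ε * p) / (2 * R) ^ n * (a * R) ^ n * (a * R) ^ n) =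
      n * w ^ 2 * R ^ n * (2 * R) ^ (ε * p) / ε := by
    generalize (2 * R) ^ (ε * p) = q
    rw [mul_pow, mul_pow, pow_mul']
    field_simp
  rw [e1]
  have e2 : n * (w * ((2 * R) ^ (ε * p) / (ε * p))) * (R ^ n * w) =
      n * w ^ 2 * R ^ n * (2 * R) ^ (ε * p) / (ε * p) := by ring
  rw [e2]
  apply div_le_div_of_nonneg_left (by positivity) hε
  nlinarith


end
end
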